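/- arXiv:1707.04731 — 7 statements merged into one kernel-verified Lean document; each statement's English description precedes it below -/
import Mathlib

section
/- For every fair division instance with n agents, m goods, and additive nonnegative integer valuations in which every good is positively valued by at least one agent, there exists an integral allocation that is simultaneously envy-free up to one good (EF1) and fractionally Pareto efficient (fPO). -/
open Finset

/-- The bundle of agent `k` under the integral allocation `a`
(good `j` goes to agent `a j`). -/
def bundle {n m : ℕ} (a : Fin m → Fin n) (k : Fin n) : Finset (Fin m) :=
  Finset.univ.filter (fun j => a j = k)

/-- Additive value of agent `i` for a set of goods (integer valuations). -/
def valN {n m : ℕ} (v : Fin n → Fin m → ℕ) (i : Fin n) (S : Finset (Fin m)) : ℕ :=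
  ∑ j ∈ S, v i j

/-- Envy-freeness up to one good. -/
def EF1 {n m : ℕ} (v : Fin n → Fin m → ℕ) (a : Fin m → Fin n) : Prop :=
  ∀ i k : Fin n, valN v i (bundle a k) ≤ valN v i (bundle a i) ∨
    ∃ j ∈ bundle a k, valN v i ((bundle a k).erase j) ≤ valN v i (bundle a i)

/-- A fractional allocation: entries in `[0,1]`, at most one unit of each good allocated. -/
def IsFracAlloc {n m : ℕ} (y : Fin n → Fin m → ℝ) : Prop :=
  (∀ i j, 0 ≤ y i j) ∧ (∀ i j, y i j ≤ 1) ∧ ∀ j, ∑ i, y i j ≤ 1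

/-- Fractional Pareto efficiency: no fractional allocation Pareto dominates `a`. -/
def fPO {n m : ℕ} (v : Fin n → Fin m → ℕ) (a : Fin m → Fin n) : Prop :=
  ¬ ∃ y : Fin n → Fin m → ℝ, IsFracAlloc y ∧
      (∀ i, (valN v i (bundle a i) : ℝ) ≤ ∑ j, y i j * (v i j : ℝ)) ∧
      ∃ i, (valN v i (bundle a i) : ℝ) < ∑ j, y i j * (v i j : ℝ)

/-- The spending of agent `k` on the set `S` at weights `w`, where every agent additionally owns a
private good of value `1 / 2`. -/
noncomputable def spend {n m : ℕ} (v : Fin n → Fin m → ℕ) (w : Fin n → ℝ) (k : Fin n)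
    (S : Finset (Fin m)) : ℝ :=
  w k * ((valN v k S : ℝ) + 1 / 2)

/-- Every good goes to an agent of maximal weighted value for it. -/
def WeightedMax {n m : ℕ} (v : Fin n → Fin m → ℕ) (w : Fin n → ℝ) (x : Fin m → Fin n) : Prop :=
  ∀ i j, w i * v i j ≤ w (x j) * v (x j) j

/-- The bundle of `k` is empty, or its spending without some good is at most `1`. -/
def SmallUpToOne {n m : ℕ} (v : Fin n → Fin m → ℕ) (w : Fin n → ℝ) (k : Fin n)
    (S : Finset (Fin m)) : Prop :=
  S = ∅ ∨ ∃ j ∈ S, spend v w k (S.erase j) ≤ 1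

/-- A weighted-welfare-maximal allocation in which all spendings are at least `L` and, up to one
good, at most `1`. -/
structure Feasible {n m : ℕ} (v : Fin n → Fin m → ℕ) (w : Fin n → ℝ) (L : ℝ)
    (x : Fin m → Fin n) : Prop where
  weightedMax : WeightedMax v w x
  le_spend : ∀ k, L ≤ spend v w k (bundle x k)
  small : ∀ k, SmallUpToOne v w k (bundle x k)

/-- A distance labelling for the graph with an edge from `a` to the owner of `j` whenever `a` has
maximal weighted value for `j`; agents of spending at most `L` are the sources. -/
structure Labelling {n m : ℕ} (v : Fin n → Fin m → ℕ) (w : Fin n → ℝ) (L : ℝ)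
    (x : Fin m → Fin n) (d : Fin n → Fin (n + 1)) : Prop where
  source : ∀ k, spend v w k (bundle x k) ≤ L → (d k : ℕ) = 0
  edge : ∀ a j, w a * v a j = w (x j) * v (x j) j → (d (x j) : ℕ) ≤ d a + 1

variable {n m : ℕ} {v : Fin n → Fin m → ℕ} {w : Fin n → ℝ} {L : ℝ}

@[simp]
lemma mem_bundle {x : Fin m → Fin n} {k : Fin n} {j : Fin m} : j ∈ bundle x k ↔ x j = k := by
  simp [bundle]

lemma valN_mono {k : Fin n} {S T : Finset (Fin m)} (h : S ⊆ T) : valN v k S ≤ valN v k T :=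
  Finset.sum_le_sum_of_subset h

lemma spend_mono (hw : ∀ i, 0 ≤ w i) {k : Fin n} {S T : Finset (Fin m)} (h : S ⊆ T) :
    spend v w k S ≤ spend v w k T := by
  have : (valN v k S : ℝ) ≤ valN v k T := by exact_mod_cast valN_mono h
  exact mul_le_mul_of_nonneg_left (by linarith) (hw k)

lemma bundle_update_self {x : Fin m → Fin n} {j : Fin m} {a : Fin n} :
    bundle (Function.update x j a) a = insert j (bundle x a) := by
  ext i
  by_cases h : i = j <;> simp [h]

lemma bundle_update_owner {x : Fin m → Fin n} {j : Fin m} {a : Fin n} (h : x j ≠ a) :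
    bundle (Function.update x j a) (x j) = (bundle x (x j)).erase j := by
  ext i
  by_cases hi : i = j <;> simp [hi, h.symm]

lemma bundle_update_of_ne {x : Fin m → Fin n} {j : Fin m} {a k : Fin n} (ha : k ≠ a)
    (hk : x j ≠ k) : bundle (Function.update x j a) k = bundle x k := by
  ext i
  by_cases hi : i = j
  · simp [hi, ha.symm, hk]
  · simp [hi]

lemma WeightedMax.update {x : Fin m → Fin n} (hx : WeightedMax v w x) {a : Fin n} {j : Fin m}
    (h : w a * v a j = w (x j) * v (x j) j) : WeightedMax v w (Function.update x j a) := by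
  intro i j'
  by_cases hj : j' = j
  · subst hj
    simpa [h] using hx i j'
  · simpa [hj] using hx i j'

lemma WeightedMax.pos_value {x : Fin m → Fin n} (hx : WeightedMax v w x) (hw : ∀ i, 0 < w i)
    (hv : ∀ j : Fin m, ∃ i : Fin n, 0 < v i j) (j : Fin m) : 1 ≤ v (x j) j := by
  obtain ⟨i, hi⟩ := hv j
  by_contra h
  have h0 : v (x j) j = 0 := by omega
  have h1 := hx i j
  have h2 : (0 : ℝ) < w i * v i j := mul_pos (hw i) (by exact_mod_cast hi)
  simp only [h0, Nat.cast_zero, mul_zero] at h1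
  linarith

/-- Weighted-welfare-maximal allocations for positive weights are fractionally Pareto efficient. -/
lemma WeightedMax.fPO {x : Fin m → Fin n} (hx : WeightedMax v w x) (hw : ∀ i, 0 < w i) :
    fPO v x := by
  rintro ⟨y, ⟨hy0, -, hy1⟩, hle, i, hi⟩
  have hlt : ∑ i, w i * (valN v i (bundle x i) : ℝ) < ∑ i, w i * ∑ j, y i j * (v i j : ℝ) :=
    Finset.sum_lt_sum (fun i _ => mul_le_mul_of_nonneg_left (hle i) (hw i).le)
      ⟨i, Finset.mem_univ i, mul_lt_mul_of_pos_left hi (hw i)⟩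
  have hval : ∑ i, w i * (valN v i (bundle x i) : ℝ) = ∑ j, w (x j) * (v (x j) j : ℝ) := by
    rw [← Finset.sum_fiberwise (s := Finset.univ) (g := x)]
    refine Finset.sum_congr rfl fun i _ => ?_
    simp only [valN, bundle, Nat.cast_sum, Finset.mul_sum]
    refine Finset.sum_congr rfl fun j hj => ?_
    rw [(Finset.mem_filter.1 hj).2]
  have hfrac : ∑ i, w i * ∑ j, y i j * (v i j : ℝ) ≤ ∑ j, w (x j) * (v (x j) j : ℝ) := by
    simp only [Finset.mul_sum]
    rw [Finset.sum_comm]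
    refine Finset.sum_le_sum fun j _ => ?_
    have h0 : 0 ≤ w (x j) * (v (x j) j : ℝ) := mul_nonneg (hw _).le (Nat.cast_nonneg _)
    calc ∑ i, w i * (y i j * (v i j : ℝ))
        ≤ ∑ i, y i j * (w (x j) * (v (x j) j : ℝ)) := Finset.sum_le_sum fun i _ => by
          rw [mul_left_comm]
          exact mul_le_mul_of_nonneg_left (hx i j) (hy0 i j)
      _ = (∑ i, y i j) * (w (x j) * (v (x j) j : ℝ)) := (Finset.sum_mul ..).symm
      _ ≤ 1 * (w (x j) * (v (x j) j : ℝ)) := mul_le_mul_of_nonneg_right (hy1 j) h0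
      _ = _ := one_mul _
  linarith

/-- A feasible allocation with spending threshold `1` is envy-free up to one good. -/
lemma Feasible.ef1 {x : Fin m → Fin n} (hx : Feasible v w 1 x) (hw : ∀ i, 0 < w i) :
    EF1 v x := by
  intro i k
  rcases hx.small k with h | ⟨j, hj, h⟩
  · left
    simp [h, valN]
  · right
    refine ⟨j, hj, ?_⟩
    have h1 := hx.le_spend i
    have h2 : w i * (valN v i ((bundle x k).erase j) : ℝ) ≤
        w k * (valN v k ((bundle x k).erase j) : ℝ) := by
      simp only [valN, Nat.cast_sum, Finset.mul_sum]
      refine Finset.sum_le_sum fun l hl => ?_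
      have hl' : x l = k := mem_bundle.1 (Finset.mem_of_mem_erase hl)
      simpa [hl'] using hx.weightedMax i l
    unfold spend at h h1
    have h3 : w i * (valN v i ((bundle x k).erase j) : ℝ) <
        w i * (valN v i (bundle x i) + 1) := by
      nlinarith [hw i, hw k]
    have h4 := lt_of_mul_lt_mul_left h3 (hw i).le
    have h5 : valN v i ((bundle x k).erase j) < valN v i (bundle x i) + 1 := by exact_mod_cast h4
    omega

section Optimal

variable {x₀ : Fin m → Fin n} {d : Fin n → Fin (n + 1)}

/-- In a labelling of maximal sum, every label strictly between `0` and `n` is witnessed by an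
incoming edge. -/
lemma exists_edge_of_maximal (hl : Labelling v w L x₀ d)
    (hmax : ∀ d', Labelling v w L x₀ d' → ∑ k, (d' k : ℕ) ≤ ∑ k, (d k : ℕ))
    {k : Fin n} (hk : (d k : ℕ) < n) (hs : L < spend v w k (bundle x₀ k)) :
    ∃ a j, x₀ j = k ∧ w a * v a j = w k * v k j ∧ d a < d k := by
  by_contra! hcon
  have hlab : Labelling v w L x₀ (Function.update d k ⟨d k + 1, by omega⟩) := by
    constructor
    · intro k' hk'
      have hne : k' ≠ k := by
        rintro rfl
        linarith
      simpa [hne] using hl.source k' hk'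
    · intro a j haj
      have h1 := hl.edge a j haj
      by_cases hj : x₀ j = k
      · have h2 := hcon a j hj (by rw [haj, hj])
        by_cases ha : a = k
        · simp [hj, ha]
        · simp only [hj, Function.update_self, Function.update_of_ne ha]
          have : (d k : ℕ) ≤ d a := h2
          omega
      · by_cases ha : a = k
        · subst ha
          simp only [Function.update_self, Function.update_of_ne hj]
          omega
        · simpa [ha, hj] using h1
  have h := hmax _ hlab
  have hlt : ∑ k, (d k : ℕ) < ∑ i, (Function.update d k ⟨d k + 1, by omega⟩ i : ℕ) := by
    refine Finset.sum_lt_sum (fun i _ => ?_) ⟨k, Finset.mem_univ k, by simp⟩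
    by_cases hi : i = k
    · subst hi
      simp
    · simp [hi]
  omega

lemma label_pos_iff (hl : Labelling v w L x₀ d)
    (hmax : ∀ d', Labelling v w L x₀ d' → ∑ k, (d' k : ℕ) ≤ ∑ k, (d k : ℕ)) {k : Fin n} :
    0 < (d k : ℕ) ↔ L < spend v w k (bundle x₀ k) := by
  constructor
  · intro h
    by_contra! hs
    have := hl.source k hs
    omega
  · intro hs
    by_contra h
    have h0 : (d k : ℕ) = 0 := by omega
    obtain ⟨a, j, -, -, hlt⟩ := exists_edge_of_maximal hl hmax (by have := k.2; omega) hs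
    have : (d a : ℕ) < d k := hlt
    omega

/-- A feasible allocation in which no good has a larger label is again labelled by `d`, so the label
sum of the goods does not drop at the optimum. -/
lemma not_lt_label (hf : Feasible v w L x₀) (hl : Labelling v w L x₀ d)
    (hmin : ∀ x, Feasible v w L x → Labelling v w L x d →
      ∑ j, (d (x₀ j) : ℕ) ≤ ∑ j, (d (x j) : ℕ))
    {x : Fin m → Fin n} (hx : Feasible v w L x)
    (hsource : ∀ k, spend v w k (bundle x k) ≤ L → (d k : ℕ) = 0)
    (hle : ∀ j, d (x j) ≤ d (x₀ j)) (g : Fin m) : ¬ d (x g) < d (x₀ g) := by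
  intro hg
  have hlab : Labelling v w L x d := by
    refine ⟨hsource, fun a j haj => le_trans (hle j) (hl.edge a j ?_)⟩
    exact haj.trans (le_antisymm (hf.weightedMax _ _) (hx.weightedMax _ _))
  have h1 := hmin x hx hlab
  have h2 : ∑ j, (d (x j) : ℕ) < ∑ j, (d (x₀ j) : ℕ) :=
    Finset.sum_lt_sum (fun j _ => hle j) ⟨g, Finset.mem_univ g, hg⟩
  omega

/-- At the optimum, no allocation arises from a feasible one by handing an agent `b` a good of
larger label: passing goods on to agents of smaller label would improve it. -/
lemma no_extra_good (hw : ∀ i, 0 < w i) (hL : L ≤ 1) (hf : Feasible v w L x₀)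
    (hl : Labelling v w L x₀ d)
    (hmax : ∀ d', Labelling v w L x₀ d' → ∑ k, (d' k : ℕ) ≤ ∑ k, (d k : ℕ))
    (hmin : ∀ x, Feasible v w L x → Labelling v w L x d →
      ∑ j, (d (x₀ j) : ℕ) ≤ ∑ j, (d (x j) : ℕ))
    (s : ℕ) : ∀ (x : Fin m → Fin n) (b : Fin n) (g : Fin m), (d b : ℕ) = s →
    (∀ k a j, (d k : ℕ) ≤ s → x₀ j = k → w a * v a j = w k * v k j → d a < d k →
      spend v w k ((bundle x₀ k).erase j) ≤ L) →
    x₀ g ≠ b → bundle x b = insert g (bundle x₀ b) →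
    (∀ j, d (x j) ≤ d (x₀ j)) → d (x g) < d (x₀ g) → WeightedMax v w x →
    (∀ k, (d k : ℕ) < s → bundle x k = bundle x₀ k) →
    (∀ k, k ≠ b → L ≤ spend v w k (bundle x k) ∧
      (spend v w k (bundle x k) ≤ L → (d k : ℕ) = 0) ∧ SmallUpToOne v w k (bundle x k)) →
    False := by
  induction s using Nat.strong_induction_on with
  | _ s ih =>
  intro x b g hb hviol hg hxb hle hlt hxw hlow hother
  have hw0 : ∀ i, 0 ≤ w i := fun i => (hw i).le
  have hgb : x g = b := mem_bundle.1 (by simp [hxb])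
  have hgrow : spend v w b (bundle x₀ b) ≤ spend v w b (bundle x b) :=
    spend_mono hw0 (by rw [hxb]; exact Finset.subset_insert _ _)
  have hg' : g ∉ bundle x₀ b := by simpa using hg
  have finish : SmallUpToOne v w b (bundle x b) → False := by
    intro hsm
    refine not_lt_label hf hl hmin (x := x) ⟨hxw, fun k => ?_, fun k => ?_⟩ (fun k hk => ?_) hle g
      hlt
    · by_cases hkb : k = b
      · subst hkb
        exact (hf.le_spend k).trans hgrow
      · exact (hother k hkb).1
    · by_cases hkb : k = b
      · subst hkb
        exact hsm
      · exact (hother k hkb).2.2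
    · by_cases hkb : k = b
      · subst hkb
        exact hl.source k (hgrow.trans hk)
      · exact (hother k hkb).2.1 hk
  by_cases hs : L < spend v w b (bundle x₀ b)
  · have hbn : (d b : ℕ) < n := by
      have h1 : (d b : ℕ) < d (x₀ g) := by rw [← hgb]; exact hlt
      have := (d (x₀ g)).2
      omega
    obtain ⟨a, j, hjb, haj, hab⟩ := exists_edge_of_maximal hl hmax hbn hs
    have hv' := hviol b a j hb.le hjb haj hab
    have hgj : g ≠ j := by
      rintro rfl
      exact hg hjb
    have hxj : x j = b := mem_bundle.1 (by simp [hxb, hjb])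
    by_cases hcase : spend v w b ((bundle x b).erase j) ≤ L
    · exact finish (Or.inr ⟨j, by simp [hxj], hcase.trans hL⟩)
    · have habn : a ≠ b := by
        rintro rfl
        exact lt_irrefl _ hab
      have hab' : (d a : ℕ) < s := hb ▸ hab
      refine ih (d a) hab' (Function.update x j a) a j rfl
        (fun k a j hk => hviol k a j (hk.trans hab'.le)) (by rw [hjb]; exact habn.symm)
        (by rw [bundle_update_self, hlow a hab']) (fun i => ?_) (by simpa [hjb] using hab)
        (hxw.update (by rw [hxj, haj])) (fun k hk => ?_) (fun k hka => ?_)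
      · by_cases hi : i = j
        · subst hi
          simpa [hjb] using hab.le
        · simpa [hi] using hle i
      · have hka : k ≠ a := by
          rintro rfl
          exact lt_irrefl _ hk
        have hkb : x j ≠ k := by
          rw [hxj]
          rintro rfl
          omega
        rw [bundle_update_of_ne hka hkb, hlow k (hk.trans hab')]
      · by_cases hkb : k = b
        · subst hkb
          have hbu : bundle (Function.update x j a) k = (bundle x k).erase j := by
            have := bundle_update_owner (x := x) (j := j) (a := a) (by rw [hxj]; exact hka)
            rwa [hxj] at this
          rw [hbu]
          push Not at hcase
          refine ⟨hcase.le, fun h => absurd h (not_le.2 hcase), Or.inr ⟨g, ?_, ?_⟩⟩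
          · simp [hgj, hgb]
          · rw [Finset.erase_right_comm, hxb, Finset.erase_insert hg']
            exact hv'.trans hL
        · rw [bundle_update_of_ne hka (by rw [hxj]; exact fun h => hkb h.symm)]
          exact hother k hkb
  · push Not at hs
    refine finish (Or.inr ⟨g, by simp [hgb], ?_⟩)
    rw [hxb, Finset.erase_insert hg']
    exact hs.trans hL

/-- At the optimum, an agent with an incoming edge through the good `j` from an agent of smaller
label spends at most `L` without `j`. -/
lemma spend_erase_le_of_edge (hw : ∀ i, 0 < w i) (hL : L ≤ 1) (hf : Feasible v w L x₀)
    (hl : Labelling v w L x₀ d)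
    (hmax : ∀ d', Labelling v w L x₀ d' → ∑ k, (d' k : ℕ) ≤ ∑ k, (d k : ℕ))
    (hmin : ∀ x, Feasible v w L x → Labelling v w L x d →
      ∑ j, (d (x₀ j) : ℕ) ≤ ∑ j, (d (x j) : ℕ))
    (s : ℕ) : ∀ k a j, (d k : ℕ) = s → x₀ j = k → w a * v a j = w k * v k j → d a < d k →
      spend v w k ((bundle x₀ k).erase j) ≤ L := by
  induction s using Nat.strong_induction_on with
  | _ s ih =>
  intro k a j hks hj haj hak
  by_contra! hcon
  have hak' : (d a : ℕ) < s := hks ▸ hak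
  have hne : k ≠ a := by
    rintro rfl
    exact lt_irrefl _ hak
  refine no_extra_good hw hL hf hl hmax hmin (d a) (Function.update x₀ j a) a j rfl
    (fun k' a' j' hk' => ih (d k') (lt_of_le_of_lt hk' hak') k' a' j' rfl)
    (by rw [hj]; exact hne) bundle_update_self (fun i => ?_) (by simpa [hj] using hak)
    (hf.weightedMax.update (by rw [hj, haj])) (fun i hi => ?_) (fun i hia => ?_)
  · by_cases hi : i = j
    · subst hi
      simpa [hj] using hak.le
    · simp [hi]
  · refine bundle_update_of_ne ?_ ?_
    · rintro rfl
      exact lt_irrefl _ hi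
    · rw [hj]
      rintro rfl
      omega
  · by_cases hik : i = k
    · subst hik
      have hbu : bundle (Function.update x₀ j a) i = (bundle x₀ i).erase j := by
        have := bundle_update_owner (x := x₀) (j := j) (a := a) (by rw [hj]; exact hia)
        rwa [hj] at this
      rw [hbu]
      refine ⟨hcon.le, fun h => absurd h (not_le.2 hcon), ?_⟩
      rcases Finset.eq_empty_or_nonempty ((bundle x₀ i).erase j) with h | ⟨l, hl'⟩
      · exact Or.inl h
      · rcases hf.small i with h | ⟨j', hj', h⟩
        · simp [h] at hl'
        · by_cases hjj : j' = j
          · subst hjj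
            exact Or.inr ⟨l, hl', (spend_mono (fun i => (hw i).le)
              (Finset.erase_subset _ _)).trans h⟩
          · refine Or.inr ⟨j', Finset.mem_erase.2 ⟨hjj, hj'⟩, le_trans (spend_mono
              (fun i => (hw i).le) ?_) h⟩
            exact Finset.erase_subset_erase _ (Finset.erase_subset _ _)
    · rw [bundle_update_of_ne hia (by rw [hj]; exact fun h => hik h.symm)]
      exact ⟨hf.le_spend i, hl.source i, hf.small i⟩

end Optimal

/-- A feasible allocation and a labelling, chosen to maximize the label sum of the agents and then to
minimize the label sum of the goods. -/
lemma exists_optimal_labelling {x : Fin m → Fin n} (hf : Feasible v w L x) :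
    ∃ (x₀ : Fin m → Fin n) (d : Fin n → Fin (n + 1)), Feasible v w L x₀ ∧ Labelling v w L x₀ d ∧
      (∀ d', Labelling v w L x₀ d' → ∑ k, (d' k : ℕ) ≤ ∑ k, (d k : ℕ)) ∧
      ∀ x, Feasible v w L x → Labelling v w L x d →
        ∑ j, (d (x₀ j) : ℕ) ≤ ∑ j, (d (x j) : ℕ) := by
  have h0 : Labelling v w L x (fun _ => 0) := ⟨by simp, by simp⟩
  obtain ⟨⟨x₁, d⟩, ⟨hf₁, hl₁⟩, h1⟩ := Set.exists_max_image
    {q : (Fin m → Fin n) × (Fin n → Fin (n + 1)) | Feasible v w L q.1 ∧ Labelling v w L q.1 q.2}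
    (fun q => ∑ k, (q.2 k : ℕ)) (Set.toFinite _) ⟨(x, fun _ => 0), hf, h0⟩
  obtain ⟨x₀, ⟨hf₀, hl₀⟩, h2⟩ := Set.exists_min_image
    {x : Fin m → Fin n | Feasible v w L x ∧ Labelling v w L x d}
    (fun x => ∑ j, (d (x j) : ℕ)) (Set.toFinite _) ⟨x₁, hf₁, hl₁⟩
  exact ⟨x₀, d, hf₀, hl₀, fun d' hd' => h1 (x₀, d') ⟨hf₀, hd'⟩,
    fun x hx hlx => h2 x ⟨hx, hlx⟩⟩

/-- Raising the weights of the agents in `R` by a small factor. -/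
lemma exists_larger_threshold {B : ℝ} {x : Fin m → Fin n} (R : Finset (Fin n))
    (hw : ∀ i, 0 < w i) (hwB : ∀ i, w i ≤ B) (hL0 : 0 < L) (hL : L < 1) (hf : Feasible v w L x)
    (hRB : ∀ k ∈ R, w k < B)
    (hR : ∀ a ∈ R, ∀ j, x j ∉ R → w a * v a j ≠ w (x j) * v (x j) j)
    (hRs : ∀ k ∈ R, bundle x k = ∅ ∨ ∃ j ∈ bundle x k, spend v w k ((bundle x k).erase j) < 1)
    (hRc : ∀ k, k ∉ R → L < spend v w k (bundle x k)) :
    ∃ w' L', L < L' ∧ L' ≤ 1 ∧ (∀ i, 0 < w' i ∧ w' i ≤ B) ∧ Feasible v w' L' x := by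
  have small_factor : ∀ c b : ℝ, c < b → ∀ᶠ t in nhdsWithin (1 : ℝ) (Set.Ioi 1), t * c < b := by
    intro c b hcb
    have hc : Filter.Tendsto (fun t : ℝ => t * c) (nhdsWithin 1 (Set.Ioi 1)) (nhds c) := by
      have : Continuous fun t : ℝ => t * c := by fun_prop
      simpa using (this.tendsto 1).mono_left nhdsWithin_le_nhds
    exact hc.eventually (gt_mem_nhds hcb)
  have e1 : ∀ᶠ t in nhdsWithin (1 : ℝ) (Set.Ioi 1), ∀ k, k ∈ R → t * w k < B := by
    refine Filter.eventually_all.2 fun k => ?_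
    by_cases hk : k ∈ R
    · simpa [hk] using small_factor _ _ (hRB k hk)
    · simp [hk]
  have e2 : ∀ᶠ t in nhdsWithin (1 : ℝ) (Set.Ioi 1), ∀ a j, a ∈ R → x j ∉ R →
      t * (w a * v a j) < w (x j) * v (x j) j := by
    refine Filter.eventually_all.2 fun a => Filter.eventually_all.2 fun j => ?_
    by_cases h : a ∈ R ∧ x j ∉ R
    · simpa [h.1, h.2] using small_factor _ _
        (lt_of_le_of_ne (hf.weightedMax a j) (hR a h.1 j h.2))
    · exact Filter.Eventually.of_forall fun t ha hj => absurd ⟨ha, hj⟩ h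
  have e3 : ∀ᶠ t in nhdsWithin (1 : ℝ) (Set.Ioi 1), ∀ k, k ∈ R →
      bundle x k = ∅ ∨ ∃ j ∈ bundle x k, t * spend v w k ((bundle x k).erase j) < 1 := by
    refine Filter.eventually_all.2 fun k => ?_
    by_cases hk : k ∈ R
    · rcases hRs k hk with h | ⟨j, hj, h⟩
      · exact Filter.Eventually.of_forall fun t _ => Or.inl h
      · exact (small_factor _ _ h).mono fun t ht _ => Or.inr ⟨j, hj, ht⟩
    · simp [hk]
  obtain ⟨t, ⟨⟨ht1, ht2⟩, ht3⟩, ht⟩ := (((e1.and e2).and e3).and self_mem_nhdsWithin).exists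
  have ht : 1 < t := ht
  set w' : Fin n → ℝ := fun k => if k ∈ R then t * w k else w k with hw'
  have hin : ∀ k ∈ R, ∀ S, spend v w' k S = t * spend v w k S := by
    intro k hk S
    simp [spend, hw', hk, mul_assoc]
  have hout : ∀ k, k ∉ R → ∀ S, spend v w' k S = spend v w k S := by
    intro k hk S
    simp [spend, hw', hk]
  have hgt : ∀ k, L < spend v w' k (bundle x k) := by
    intro k
    by_cases hk : k ∈ R
    · rw [hin k hk]
      nlinarith [hf.le_spend k]
    · rw [hout k hk]
      exact hRc k hk
  have e4 : ∀ᶠ L' in nhdsWithin L (Set.Ioi L), ∀ k, L' < spend v w' k (bundle x k) :=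
    Filter.eventually_all.2 fun k =>
      (Filter.Tendsto.mono_left Filter.tendsto_id nhdsWithin_le_nhds).eventually
        (gt_mem_nhds (hgt k))
  have e5 : ∀ᶠ L' in nhdsWithin L (Set.Ioi L), L' < 1 :=
    (Filter.Tendsto.mono_left Filter.tendsto_id nhdsWithin_le_nhds).eventually (gt_mem_nhds hL)
  obtain ⟨L', ⟨h4, h5⟩, hLL⟩ := ((e4.and e5).and self_mem_nhdsWithin).exists
  refine ⟨w', L', hLL, h5.le, fun i => ?_, ⟨fun i j => ?_, fun k => (h4 k).le, fun k => ?_⟩⟩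
  · by_cases hi : i ∈ R
    · simp only [hw', hi, if_true]
      exact ⟨mul_pos (by linarith) (hw i), (ht1 i hi).le⟩
    · simp only [hw', hi, if_false]
      exact ⟨hw i, hwB i⟩
  · have h := hf.weightedMax i j
    have h0 : 0 ≤ w (x j) * v (x j) j := mul_nonneg (hw _).le (Nat.cast_nonneg _)
    by_cases hi : i ∈ R <;> by_cases hj : x j ∈ R <;> simp only [hw', hi, hj, if_true, if_false]
    · nlinarith
    · have := ht2 i j hi hj
      linarith
    · nlinarith
    · exact h
  · by_cases hk : k ∈ R
    · rcases ht3 k hk with h | ⟨j, hj, h⟩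
      · exact Or.inl h
      · exact Or.inr ⟨j, hj, by rw [hin k hk]; exact h.le⟩
    · rcases hf.small k with h | ⟨j, hj, h⟩
      · exact Or.inl h
      · exact Or.inr ⟨j, hj, by rw [hout k hk]; exact h⟩

/-- A bound on all values. -/
def valueBound (v : Fin n → Fin m → ℕ) : ℕ := (∑ i, ∑ j, v i j) + 1

lemma valN_le_sum (i : Fin n) (S : Finset (Fin m)) : valN v i S ≤ ∑ i, ∑ j, v i j :=
  (valN_mono (Finset.subset_univ S)).trans
    (Finset.single_le_sum (f := fun i => ∑ j, v i j) (fun _ _ => Nat.zero_le _)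
      (Finset.mem_univ i))

lemma value_le_valueBound (i : Fin n) (j : Fin m) : v i j ≤ valueBound v := by
  have := valN_le_sum (v := v) i {j}
  simp only [valN, Finset.sum_singleton] at this
  unfold valueBound
  omega

/-- A feasible threshold below `1` is not maximal. -/
lemma Feasible.exists_improvement {x : Fin m → Fin n}
    (hv : ∀ j : Fin m, ∃ i : Fin n, 0 < v i j) (hw : ∀ i, 0 < w i)
    (hwB : ∀ i, w i ≤ 2 * (valueBound v : ℝ) ^ n) (hL0 : 0 < L) (hL : L < 1)
    (hf : Feasible v w L x) :
    ∃ x' w' L', L < L' ∧ L' ≤ 1 ∧ (∀ i, 0 < w' i ∧ w' i ≤ 2 * (valueBound v : ℝ) ^ n) ∧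
      Feasible v w' L' x' := by
  obtain ⟨x₀, d, hf₀, hl, hmax, hmin⟩ := exists_optimal_labelling hf
  have hV : (1 : ℝ) ≤ valueBound v := by
    exact_mod_cast Nat.le_add_left 1 _
  obtain ⟨s, hs⟩ : ∃ s, ∀ k, d k ≠ s := by
    have hns : ¬ Function.Surjective d := by
      intro h
      simpa using Fintype.card_le_of_surjective d h
    simpa [Function.Surjective] using hns
  have hsn : (s : ℕ) ≤ n := Nat.lt_succ_iff.1 s.2
  have hviol := fun k a j => spend_erase_le_of_edge hw hL.le hf₀ hl hmax hmin (d k) k a j rfl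
  have hbound : ∀ t : ℕ, ∀ k, (d k : ℕ) = t → t < n → w k < 2 * (valueBound v : ℝ) ^ t := by
    intro t
    induction t using Nat.strong_induction_on with
    | _ t ih =>
    intro k hk htn
    by_cases hpos : L < spend v w k (bundle x₀ k)
    · obtain ⟨a, j, hj, haj, hak⟩ := exists_edge_of_maximal hl hmax (hk ▸ htn) hpos
      have hak' : (d a : ℕ) < t := hk ▸ hak
      have hwa := ih (d a) hak' a rfl (by omega)
      have h1 : (1 : ℝ) ≤ v k j := by
        have := hf₀.weightedMax.pos_value hw hv j
        rw [hj] at this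
        exact_mod_cast this
      have h2 : (v a j : ℝ) ≤ valueBound v := by exact_mod_cast value_le_valueBound a j
      have hpow : (valueBound v : ℝ) ^ ((d a : ℕ) + 1) ≤ (valueBound v : ℝ) ^ t :=
        pow_le_pow_right₀ hV hak'
      calc w k ≤ w k * v k j := le_mul_of_one_le_right (hw k).le h1
        _ = w a * v a j := haj.symm
        _ ≤ w a * valueBound v := mul_le_mul_of_nonneg_left h2 (hw a).le
        _ < 2 * (valueBound v : ℝ) ^ (d a : ℕ) * valueBound v :=
          mul_lt_mul_of_pos_right hwa (by linarith)
        _ = 2 * (valueBound v : ℝ) ^ ((d a : ℕ) + 1) := by ring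
        _ ≤ _ := by linarith
    · push Not at hpos
      have h1 : (0 : ℝ) ≤ w k * valN v k (bundle x₀ k) := mul_nonneg (hw k).le (Nat.cast_nonneg _)
      have h2 : (1 : ℝ) ≤ (valueBound v : ℝ) ^ t := one_le_pow₀ hV
      unfold spend at hpos
      linarith
  have hRmem : ∀ k, k ∈ Finset.univ.filter (fun k => d k < s) ↔ d k < s := by simp
  refine ⟨x₀, exists_larger_threshold (Finset.univ.filter fun k => d k < s) hw hwB hL0 hL hf₀
    (fun k hk => ?_) (fun a ha j hj haj => ?_) (fun k hk => ?_) (fun k hk => ?_)⟩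
  · have hk : (d k : ℕ) < s := (hRmem k).1 hk
    have hpow : (valueBound v : ℝ) ^ (d k : ℕ) ≤ (valueBound v : ℝ) ^ n :=
      pow_le_pow_right₀ hV (by omega)
    linarith [hbound (d k) k rfl (by omega)]
  · have ha : (d a : ℕ) < s := (hRmem a).1 ha
    have hj : ¬ d (x₀ j) < s := fun h => hj ((hRmem _).2 h)
    have hj' : ¬ (d (x₀ j) : ℕ) < s := hj
    have := hl.edge a j haj
    exact hs (x₀ j) (Fin.ext (by omega))
  · have hk : (d k : ℕ) < s := (hRmem k).1 hk
    by_cases hpos : L < spend v w k (bundle x₀ k)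
    · obtain ⟨a, j, hj, haj, hak⟩ := exists_edge_of_maximal hl hmax (by omega) hpos
      exact Or.inr ⟨j, mem_bundle.2 hj, (hviol k a j hj haj hak).trans_lt hL⟩
    · push Not at hpos
      rcases Finset.eq_empty_or_nonempty (bundle x₀ k) with h | ⟨j, hj⟩
      · exact Or.inl h
      · exact Or.inr ⟨j, hj, ((spend_mono (fun i => (hw i).le)
          (Finset.erase_subset _ _)).trans hpos).trans_lt hL⟩
  · rw [hRmem] at hk
    refine (label_pos_iff hl hmax).1 ?_
    have h1 := hs k
    by_contra h
    have h2 : ¬ (d k : ℕ) < s := hk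
    exact h1 (Fin.ext (by omega))

/-- Feasibility is a closed condition on the threshold and the weights. -/
lemma isClosed_feasible (v : Fin n → Fin m → ℕ) (x : Fin m → Fin n) :
    IsClosed {q : ℝ × (Fin n → ℝ) | Feasible v q.2 q.1 x} := by
  have hset : {q : ℝ × (Fin n → ℝ) | Feasible v q.2 q.1 x} =
      {q | ∀ i j, q.2 i * (v i j : ℝ) ≤ q.2 (x j) * (v (x j) j : ℝ)} ∩
      {q | ∀ k, q.1 ≤ spend v q.2 k (bundle x k)} ∩
      {q | ∀ k, bundle x k = ∅ ∨ ∃ j ∈ bundle x k, spend v q.2 k ((bundle x k).erase j) ≤ 1} := by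
    ext q
    exact ⟨fun h => ⟨⟨h.1, h.2⟩, h.3⟩, fun h => ⟨h.1.1, h.1.2, h.2⟩⟩
  rw [hset]
  unfold spend
  refine (IsClosed.inter ?_ ?_).inter ?_
  · simp only [Set.ofPred_forall]
    exact isClosed_iInter fun i => isClosed_iInter fun j =>
      isClosed_le (by fun_prop) (by fun_prop)
  · simp only [Set.ofPred_forall]
    exact isClosed_iInter fun k => isClosed_le (by fun_prop) (by fun_prop)
  · simp only [Set.ofPred_forall]
    refine isClosed_iInter fun k => ?_
    rw [Set.ofPred_or]
    refine isClosed_const.union ?_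
    have hU : {q : ℝ × (Fin n → ℝ) | ∃ j ∈ bundle x k,
        q.2 k * ((valN v k ((bundle x k).erase j) : ℝ) + 1 / 2) ≤ 1} =
        ⋃ j ∈ bundle x k, {q : ℝ × (Fin n → ℝ) |
          q.2 k * ((valN v k ((bundle x k).erase j) : ℝ) + 1 / 2) ≤ 1} := by
      ext q
      simp
    rw [hU]
    exact isClosed_biUnion_finset fun j _ => isClosed_le (by fun_prop) (by fun_prop)

/-- Small constant weights are feasible for some positive threshold. -/
lemma exists_feasible (hn : 0 < n) (v : Fin n → Fin m → ℕ) :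
    ∃ x w L, 0 < L ∧ L ≤ 1 ∧ (∀ i, 0 ≤ w i ∧ w i ≤ 2 * (valueBound v : ℝ) ^ n) ∧
      Feasible v w L x := by
  have : Nonempty (Fin n) := ⟨⟨0, hn⟩⟩
  choose x hx using fun j : Fin m => Finite.exists_max fun i : Fin n => v i j
  have hV : (1 : ℝ) ≤ valueBound v := by
    exact_mod_cast Nat.le_add_left 1 _
  have hV0 : (0 : ℝ) < valueBound v := by linarith
  have hinv : 0 < (valueBound v : ℝ)⁻¹ := inv_pos.2 hV0
  have hinv1 : (valueBound v : ℝ)⁻¹ ≤ 1 := inv_le_one_of_one_le₀ hV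
  refine ⟨x, fun _ => (valueBound v : ℝ)⁻¹, (valueBound v : ℝ)⁻¹ / 2, by linarith, by linarith,
    fun i => ⟨hinv.le, ?_⟩, ⟨fun i j => ?_, fun k => ?_, fun k => ?_⟩⟩
  · have : (1 : ℝ) ≤ (valueBound v : ℝ) ^ n := one_le_pow₀ hV
    linarith
  · exact mul_le_mul_of_nonneg_left (by exact_mod_cast hx j i) hinv.le
  · unfold spend
    have : (0 : ℝ) ≤ (valueBound v : ℝ)⁻¹ * valN v k (bundle x k) :=
      mul_nonneg hinv.le (Nat.cast_nonneg _)
    linarith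
  · rcases Finset.eq_empty_or_nonempty (bundle x k) with h | ⟨j, hj⟩
    · exact Or.inl h
    · refine Or.inr ⟨j, hj, ?_⟩
      have h1 : (valN v k ((bundle x k).erase j) : ℝ) + 1 ≤ valueBound v := by
        have : valN v k ((bundle x k).erase j) + 1 ≤ valueBound v :=
          Nat.succ_le_succ (valN_le_sum k _)
        exact_mod_cast this
      calc (valueBound v : ℝ)⁻¹ * ((valN v k ((bundle x k).erase j) : ℝ) + 1 / 2)
          ≤ (valueBound v : ℝ)⁻¹ * valueBound v :=
            mul_le_mul_of_nonneg_left (by linarith) hinv.le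
        _ = 1 := inv_mul_cancel₀ hV0.ne'

lemma Feasible.pos_weight {x : Fin m → Fin n} (hf : Feasible v w L x) (hL : 0 < L) (i : Fin n) :
    0 < w i := by
  have h := hL.trans_le (hf.le_spend i)
  exact pos_of_mul_pos_left h (by positivity)

/-- Some allocation is feasible with positive weights and threshold `1`. -/
lemma exists_feasible_one (hn : 0 < n) (hv : ∀ j : Fin m, ∃ i : Fin n, 0 < v i j) :
    ∃ x w, (∀ i, 0 < w i) ∧ Feasible v w 1 x := by
  set B : ℝ := 2 * (valueBound v : ℝ) ^ n with hB
  set T : Set (ℝ × (Fin n → ℝ)) := (Set.Icc 0 1 ×ˢ Set.Icc (fun _ => 0) (fun _ => B)) ∩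
    ⋃ x : Fin m → Fin n, {q | Feasible v q.2 q.1 x} with hT
  have hTc : IsCompact T := (isCompact_Icc.prod isCompact_Icc).inter_right
    (isClosed_iUnion_of_finite fun x => isClosed_feasible v x)
  have hmem : ∀ {x w L}, 0 ≤ L → L ≤ 1 → (∀ i, 0 ≤ w i ∧ w i ≤ B) → Feasible v w L x →
      (L, w) ∈ T := fun h0 h1 hw hf =>
    ⟨⟨⟨h0, h1⟩, fun i => (hw i).1, fun i => (hw i).2⟩, Set.mem_iUnion.2 ⟨_, hf⟩⟩
  obtain ⟨x₁, w₁, L₁, hL₁, hL₁', hw₁, hf₁⟩ := exists_feasible hn v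
  have h₁ := hmem hL₁.le hL₁' hw₁ hf₁
  obtain ⟨⟨L, w⟩, ⟨⟨hLI, hwI⟩, hU⟩, hopt⟩ := hTc.exists_isMaxOn ⟨_, h₁⟩ continuous_fst.continuousOn
  obtain ⟨x, hf⟩ := Set.mem_iUnion.1 hU
  have hf : Feasible v w L x := hf
  have hL0 : 0 < L := hL₁.trans_le (hopt h₁)
  have hw := hf.pos_weight hL0
  rcases lt_or_eq_of_le (show L ≤ 1 from hLI.2) with hlt | rfl
  · obtain ⟨x', w', L', hLL, hL1, hw', hf'⟩ :=
      hf.exists_improvement hv hw (fun i => hwI.2 i) hL0 hlt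
    have : L' ≤ L := hopt (hmem (by linarith) hL1 (fun i => ⟨(hw' i).1.le, (hw' i).2⟩) hf')
    linarith
  · exact ⟨x, w, hw, hf⟩

/-- For every fair division instance with additive nonnegative integer valuations in which
every good is positively valued by some agent, there exists an integral allocation that is
simultaneously EF1 and fractionally Pareto efficient. -/
theorem ef1_and_fpo_exists (n m : ℕ) (hn : 0 < n)
    (v : Fin n → Fin m → ℕ) (hv : ∀ j : Fin m, ∃ i : Fin n, 0 < v i j) :
    ∃ a : Fin m → Fin n, EF1 v a ∧ fPO v a := by
  obtain ⟨x, w, hw, hf⟩ := exists_feasible_one hn hv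
  exact ⟨x, hf.ef1 hw, hf.weightedMax.fPO hw⟩
end

section
/- For every fair division instance with n agents, m goods, and additive nonnegative integer valuations in which every good is positively valued by at least one agent, there exists an integral allocation that is simultaneously envy-free up to one good (EF1) and Pareto efficient (PO). -/
open Finset

/-- Pareto efficiency with respect to integral allocations. -/
def PO {n m : ℕ} (v : Fin n → Fin m → ℕ) (a : Fin m → Fin n) : Prop :=
  ¬ ∃ b : Fin m → Fin n,
      (∀ i, valN v i (bundle a i) ≤ valN v i (bundle b i)) ∧
      ∃ i, valN v i (bundle a i) < valN v i (bundle b i)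

/-- The number of agents of positive utility, followed lexicographically by the product of
the positive utilities. -/
def nashScore {ι : Type*} [Fintype ι] (u : ι → ℕ) : ℕ ×ₗ ℕ :=
  toLex ((univ.filter fun i => 0 < u i).card, ∏ i, max 1 (u i))

theorem nashScore_lt_of_support_ssubset {ι : Type*} [Fintype ι] {u w : ι → ℕ}
    (h : ∀ i, 0 < u i → 0 < w i) {i : ι} (hu : u i = 0) (hw : 0 < w i) :
    nashScore u < nashScore w := by
  refine Prod.Lex.toLex_lt_toLex.2 (Or.inl (card_lt_card ?_))
  refine (ssubset_iff_of_subset fun j hj => ?_).2 ⟨i, by simpa using hw, by simp [hu]⟩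
  simpa using h j (by simpa using hj)

theorem nashScore_lt_of_prod_lt {ι : Type*} [Fintype ι] {u w : ι → ℕ}
    (h : ∀ i, 0 < u i → 0 < w i) (hlt : ∏ i, max 1 (u i) < ∏ i, max 1 (w i)) :
    nashScore u < nashScore w := by
  refine Prod.Lex.toLex_lt_toLex.2 ?_
  have hle : (univ.filter fun i => 0 < u i).card ≤ (univ.filter fun i => 0 < w i).card :=
    card_le_card (monotone_filter_right _ fun i _ => h i)
  rcases hle.lt_or_eq with hc | hc
  · exact Or.inl hc
  · exact Or.inr ⟨hc, hlt⟩

theorem nashScore_strictMono {ι : Type*} [Fintype ι] :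
    StrictMono (nashScore : (ι → ℕ) → ℕ ×ₗ ℕ) := by
  intro u w huw
  obtain ⟨hle, i, hi⟩ := Pi.lt_def.1 huw
  have hpos : ∀ j, 0 < u j → 0 < w j := fun j hj => hj.trans_le (hle j)
  rcases Nat.eq_zero_or_pos (u i) with h0 | h0
  · exact nashScore_lt_of_support_ssubset hpos h0 (by omega)
  · refine nashScore_lt_of_prod_lt hpos (prod_lt_prod (fun j _ => by positivity)
      (fun j _ => max_le_max le_rfl (hle j)) ⟨i, mem_univ i, by omega⟩)

/-- A change in the utilities of two agents that raises their product raises the score. -/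
theorem nashScore_lt_of_mul_lt_mul {ι : Type*} [Fintype ι] [DecidableEq ι] {u w : ι → ℕ}
    {i k : ι} (hik : i ≠ k) (h : ∀ l, l ≠ i → l ≠ k → w l = u l)
    (hlt : u i * u k < w i * w k) : nashScore u < nashScore w := by
  have hwi : 0 < w i := Nat.pos_of_mul_pos_right (Nat.zero_lt_of_lt hlt)
  have hwk : 0 < w k := Nat.pos_of_mul_pos_left (Nat.zero_lt_of_lt hlt)
  have hpos : ∀ l, 0 < u l → 0 < w l := by
    intro l hl
    by_cases hli : l = i
    · rwa [hli]
    by_cases hlk : l = k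
    · rwa [hlk]
    rwa [h l hli hlk]
  rcases Nat.eq_zero_or_pos (u i) with hi | hi
  · exact nashScore_lt_of_support_ssubset hpos hi hwi
  rcases Nat.eq_zero_or_pos (u k) with hk | hk
  · exact nashScore_lt_of_support_ssubset hpos hk hwk
  refine nashScore_lt_of_prod_lt hpos ?_
  have hkmem : k ∈ univ.erase i := by simp [hik.symm]
  rw [← mul_prod_erase univ _ (mem_univ i), ← mul_prod_erase univ _ (mem_univ i),
    ← mul_prod_erase _ _ hkmem, ← mul_prod_erase _ _ hkmem, ← mul_assoc, ← mul_assoc,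
    max_eq_right hi, max_eq_right hk, max_eq_right hwi, max_eq_right hwk]
  have hrest : ∏ l ∈ (univ.erase i).erase k, max 1 (w l) =
      ∏ l ∈ (univ.erase i).erase k, max 1 (u l) := by
    refine prod_congr rfl fun l hl => ?_
    simp only [mem_erase, mem_univ, and_true] at hl
    rw [h l hl.2 hl.1]
  rw [hrest]
  exact Nat.mul_lt_mul_of_pos_right hlt (prod_pos fun l _ => by positivity)

theorem exists_mul_sum_le_mul_sum {α : Type*} (S : Finset α) (f g : α → ℕ)
    (hf : 0 < ∑ j ∈ S, f j) :
    ∃ j ∈ S, 0 < f j ∧ g j * ∑ l ∈ S, f l ≤ f j * ∑ l ∈ S, g l := by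
  by_contra! hcon
  obtain ⟨j, hj, hj0⟩ := sum_pos_iff.1 hf
  have hlt : ∑ j ∈ S, f j * ∑ l ∈ S, g l < ∑ j ∈ S, g j * ∑ l ∈ S, f l := by
    refine sum_lt_sum (fun l hl => ?_) ⟨j, hj, hcon j hj hj0⟩
    rcases Nat.eq_zero_or_pos (f l) with h0 | h0
    · simp [h0]
    · exact (hcon l hl h0).le
  rw [← sum_mul, ← sum_mul, mul_comm] at hlt
  exact lt_irrefl _ hlt

section Transfer

variable {n m : ℕ} (v : Fin n → Fin m → ℕ) (a : Fin m → Fin n) {i k : Fin n} {j : Fin m}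

theorem valN_erase_add (l : Fin n) {S : Finset (Fin m)} (hj : j ∈ S) :
    valN v l (S.erase j) + v l j = valN v l S :=
  sum_erase_add S (v l) hj

theorem bundle_update_giver (hik : i ≠ k) :
    bundle (Function.update a j i) k = (bundle a k).erase j := by
  ext l
  by_cases hl : l = j <;> simp [bundle, Function.update_apply, hl, hik]

theorem valN_bundle_update_receiver (hj : a j ≠ i) :
    valN v i (bundle (Function.update a j i) i) = valN v i (bundle a i) + v i j := by
  have hins : bundle (Function.update a j i) i = insert j (bundle a i) := by
    ext l
    by_cases hl : l = j <;> simp [bundle, Function.update_apply, hl]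
  rw [hins, valN, sum_insert (by simpa [bundle] using hj), add_comm, valN]

theorem bundle_update_of_ne_s1 {l : Fin n} (hli : l ≠ i) (hlj : l ≠ a j) :
    bundle (Function.update a j i) l = bundle a l := by
  ext p
  by_cases hp : p = j <;> simp [bundle, Function.update_apply, hp, hli.symm, hlj.symm]

end Transfer

/-- Utility profile of an allocation. -/
def utility {n m : ℕ} (v : Fin n → Fin m → ℕ) (a : Fin m → Fin n) (i : Fin n) : ℕ :=
  valN v i (bundle a i)

theorem po_of_nashScore_max {n m : ℕ} {v : Fin n → Fin m → ℕ} {a : Fin m → Fin n}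
    (hmax : ∀ b, nashScore (utility v b) ≤ nashScore (utility v a)) : PO v a := by
  rintro ⟨b, hle, hlt⟩
  exact (hmax b).not_gt (nashScore_strictMono (Pi.lt_def.2 ⟨hle, hlt⟩))

theorem ef1_of_nashScore_max {n m : ℕ} {v : Fin n → Fin m → ℕ} {a : Fin m → Fin n}
    (hmax : ∀ b, nashScore (utility v b) ≤ nashScore (utility v a)) : EF1 v a := by
  intro i k
  by_contra! ⟨henvy, herase⟩
  have hik : i ≠ k := by
    rintro rfl
    exact lt_irrefl _ henvy
  obtain ⟨j, hj, hpos, hratio⟩ := exists_mul_sum_le_mul_sum (bundle a k) (v i) (v k)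
    (Nat.zero_lt_of_lt henvy)
  change v k j * valN v i (bundle a k) ≤ v i j * valN v k (bundle a k) at hratio
  have hak : a j = k := by simpa [bundle] using hj
  have hi : utility v (Function.update a j i) i = utility v a i + v i j :=
    valN_bundle_update_receiver v a (by rw [hak]; exact hik.symm)
  have hk : utility v (Function.update a j i) k + v k j = utility v a k := by
    rw [utility, bundle_update_giver a hik]
    exact valN_erase_add v k hj
  have hother : ∀ l, l ≠ i → l ≠ k →
      utility v (Function.update a j i) l = utility v a l := fun l hli hlk => by
    rw [utility, bundle_update_of_ne_s1 a hli (by rwa [hak]), utility]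
  refine (hmax (Function.update a j i)).not_gt ?_
  rcases Nat.eq_zero_or_pos (v k j) with h0 | h0
  · refine nashScore_strictMono (Pi.lt_def.2 ⟨fun l => ?_, i, by omega⟩)
    change utility v a l ≤ utility v (Function.update a j i) l
    by_cases hli : l = i
    · rw [hli]; omega
    by_cases hlk : l = k
    · rw [hlk]; omega
    exact (hother l hli hlk).ge
  · refine nashScore_lt_of_mul_lt_mul hik hother ?_
    have hT : utility v a i + v i j < valN v i (bundle a k) := by
      have h1 := herase j hj
      have h2 := valN_erase_add v i hj
      unfold utility
      omega
    change _ ≤ v i j * utility v a k at hratio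
    rw [hi, ← hk]
    rw [← hk] at hratio
    nlinarith [Nat.mul_lt_mul_of_pos_left hT h0]

/-- For every fair division instance with additive nonnegative integer valuations in which
every good is positively valued by some agent, there exists an integral allocation that is
simultaneously EF1 and Pareto efficient. -/
theorem ef1_and_po_exists (n m : ℕ) (hn : 0 < n)
    (v : Fin n → Fin m → ℕ) (hv : ∀ j : Fin m, ∃ i : Fin n, 0 < v i j) :
    ∃ a : Fin m → Fin n, EF1 v a ∧ PO v a := by
  have : Nonempty (Fin m → Fin n) := ⟨fun _ => ⟨0, hn⟩⟩
  obtain ⟨a, ha⟩ := Finite.exists_max fun a : Fin m → Fin n => nashScore (utility v a)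
  exact ⟨a, ef1_of_nashScore_max ha, po_of_nashScore_max ha⟩
end

section
/- Second welfare theorem for Fisher markets: let x be an integral allocation of m goods to n agents with additive nonnegative valuations, where every good is positively valued by some agent and every agent positively values some good, and suppose x is fractionally Pareto efficient. Then there exists a price vector p with p_j > 0 for every good j such that x_i ⊆ MBB_i for every agent i; consequently, setting endowments e_i = p(x_i), the pair (x,p) is a market equilibrium of the Fisher market with valuations v and endowments e (it satisfies market clearing, budget exhaustion, and the MBB allocation condition). -/
open Finset

/-- Fractional Pareto efficiency of an integral allocation (real valuations). -/
def fPOR {n m : ℕ} (v : Fin n → Fin m → ℝ) (a : Fin m → Fin n) : Prop :=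
  ¬ ∃ y : Fin n → Fin m → ℝ, IsFracAlloc y ∧
      (∀ i, (∑ j ∈ bundle a i, v i j) ≤ ∑ j, y i j * v i j) ∧
      ∃ i, (∑ j ∈ bundle a i, v i j) < ∑ j, y i j * v i j

/-- **Farkas' lemma** for finitely many linear functionals: `b` is a nonnegative combination of
the `f i`, or some vector is nonpositive for all `f i` and positive for `b`. -/
theorem farkas_alternative {V ι : Type*} [AddCommGroup V] [Module ℝ V] (s : Finset ι)
    (f : ι → V →ₗ[ℝ] ℝ) (b : V →ₗ[ℝ] ℝ) :
    (∃ c : ι → ℝ, (∀ i, 0 ≤ c i) ∧ b = ∑ i ∈ s, c i • f i) ∨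
      ∃ x, (∀ i ∈ s, f i x ≤ 0) ∧ 0 < b x := by
  classical
  induction s using Finset.induction_on generalizing f b with
  | empty =>
    by_cases hb : b = 0
    · exact Or.inl ⟨0, fun _ => le_rfl, by simp [hb]⟩
    · obtain ⟨x, hx⟩ : ∃ x, b x ≠ 0 := by
        by_contra! h
        exact hb (LinearMap.ext h)
      rcases lt_or_gt_of_ne hx with hx | hx
      · exact Or.inr ⟨-x, by simp, by simpa using hx⟩
      · exact Or.inr ⟨x, by simp, hx⟩
  | insert k s hk ih =>
    rcases ih f b with ⟨c, hc, hb⟩ | ⟨x, hx, hbx⟩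
    · refine Or.inl ⟨Function.update c k 0, fun i => ?_, ?_⟩
      · by_cases hik : i = k <;> simp [hik, hc]
      · rw [hb, Finset.sum_insert hk]
        simp only [Function.update_self, zero_smul, zero_add]
        refine Finset.sum_congr rfl fun i hi => ?_
        rw [Function.update_of_ne (ne_of_mem_of_not_mem hi hk)]
    · by_cases hkx : f k x ≤ 0
      · exact Or.inr ⟨x, by simpa [hkx] using hx, hbx⟩
      push Not at hkx
      rcases ih (fun i => f i - (f i x / f k x) • f k) (b - (b x / f k x) • f k) with
        ⟨c, hc, hb⟩ | ⟨y, hy, hby⟩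
      · refine Or.inl ⟨Function.update c k (b x / f k x - ∑ i ∈ s, c i * (f i x / f k x)),
          fun i => ?_, ?_⟩
        · by_cases hik : i = k
          · subst hik
            have hsum : ∑ j ∈ s, c j * (f j x / f i x) ≤ 0 := Finset.sum_nonpos fun j hj =>
              mul_nonpos_of_nonneg_of_nonpos (hc j) (div_nonpos_of_nonpos_of_nonneg (hx j hj) hkx.le)
            have := div_pos hbx hkx
            simp only [Function.update_self]
            linarith
          · simp [hik, hc]
        · have hs : ∑ i ∈ s, Function.update c k
              (b x / f k x - ∑ i ∈ s, c i * (f i x / f k x)) i • f i = ∑ i ∈ s, c i • f i :=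
            Finset.sum_congr rfl fun i hi => by
              rw [Function.update_of_ne (ne_of_mem_of_not_mem hi hk)]
          rw [Finset.sum_insert hk, hs, Function.update_self]
          simp only [smul_sub, smul_smul, Finset.sum_sub_distrib, ← Finset.sum_smul] at hb
          refine (sub_eq_iff_eq_add.1 hb).trans ?_
          module
      · refine Or.inr ⟨y - (f k y / f k x) • x, fun i hi => ?_, ?_⟩
        · rcases Finset.mem_insert.1 hi with rfl | hi
          · simp [hkx.ne']
          · have h := hy i hi
            simp only [LinearMap.sub_apply, LinearMap.smul_apply, smul_eq_mul, map_sub,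
              map_smul] at h ⊢
            convert h using 1
            ring
        · simp only [LinearMap.sub_apply, LinearMap.smul_apply, smul_eq_mul, map_sub,
            map_smul] at hby ⊢
          convert hby using 1
          ring

/-- Reassigning an amount `c k j` of each good `j` to each agent `k`, out of the bundle of its
owner, cannot weakly benefit everybody and strictly benefit somebody. -/
theorem fPOR.not_exists_improving_transfer {n m : ℕ} {v : Fin n → Fin m → ℝ}
    {a : Fin m → Fin n} (hfpo : fPOR v a) {c : Fin n → Fin m → ℝ} (hc : ∀ k j, 0 ≤ c k j)
    (hle : ∀ t, 0 ≤ ∑ j, c t j * v t j - ∑ j ∈ bundle a t, (∑ k, c k j) * v t j) (i : Fin n) :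
    ∑ j, c i j * v i j - ∑ j ∈ bundle a i, (∑ k, c k j) * v i j ≤ 0 := by
  by_contra! hi
  set S := ∑ j, ∑ k, c k j with hS
  have hS0 : 0 ≤ S := Finset.sum_nonneg fun j _ => Finset.sum_nonneg fun k _ => hc k j
  have hcol : ∀ j, ∑ k, c k j ≤ S := fun j =>
    Finset.single_le_sum (f := fun j => ∑ k, c k j)
      (fun j _ => Finset.sum_nonneg fun k _ => hc k j) (Finset.mem_univ j)
  set ε := (1 + S)⁻¹ with hε
  have hε0 : 0 < ε := by positivity
  have hεcol : ∀ j, ε * ∑ k, c k j ≤ 1 := fun j => by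
    calc ε * ∑ k, c k j ≤ ε * (1 + S) := by gcongr; linarith [hcol j]
      _ = 1 := inv_mul_cancel₀ (by positivity)
  let y : Fin n → Fin m → ℝ := fun t j =>
    (if a j = t then 1 - ε * ∑ k, c k j else 0) + ε * c t j
  have hy0 : ∀ t j, 0 ≤ y t j := fun t j => by
    have := hεcol j
    have := mul_nonneg hε0.le (hc t j)
    simp only [y]
    split_ifs <;> linarith
  have hysum : ∀ j, ∑ t, y t j = 1 := fun j => by
    simp [y, Finset.sum_add_distrib, Finset.mul_sum]
  have hval : ∀ t, ∑ j, y t j * v t j = ∑ j ∈ bundle a t, v t j +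
      ε * (∑ j, c t j * v t j - ∑ j ∈ bundle a t, (∑ k, c k j) * v t j) := fun t => by
    simp only [y, bundle, Finset.sum_filter, mul_sub, Finset.mul_sum (s := Finset.univ (α := Fin m)),
      ← Finset.sum_sub_distrib, ← Finset.sum_add_distrib]
    refine Finset.sum_congr rfl fun j _ => ?_
    split_ifs <;> ring
  refine hfpo ⟨y, ⟨hy0, fun t j => ?_, fun j => (hysum j).le⟩, fun t => ?_, i, ?_⟩
  · rw [← hysum j]
    exact Finset.single_le_sum (f := fun t => y t j) (fun t _ => hy0 t j) (Finset.mem_univ t)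
  · rw [hval]
    linarith [mul_nonneg hε0.le (hle t)]
  · rw [hval]
    linarith [mul_pos hε0 hi]

/-- A fractionally Pareto efficient allocation gives each good to an agent who maximizes the
weighted valuation of it, for some positive weights. -/
theorem fPOR.exists_pos_weights {n m : ℕ} {v : Fin n → Fin m → ℝ} {a : Fin m → Fin n}
    (hfpo : fPOR v a) :
    ∃ w : Fin n → ℝ, (∀ i, 0 < w i) ∧ ∀ i j, w i * v i j ≤ w (a j) * v (a j) j := by
  have key : ∀ i : Fin n, ∃ w : Fin n → ℝ, (∀ k, 0 ≤ w k) ∧ 0 < w i ∧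
      ∀ k j, w k * v k j ≤ w (a j) * v (a j) j := by
    intro i
    let e : Fin n → (Fin n → ℝ) →ₗ[ℝ] ℝ := fun k => LinearMap.proj k
    let f : (Fin n × Fin m) ⊕ Fin n → (Fin n → ℝ) →ₗ[ℝ] ℝ :=
      Sum.elim (fun q => v q.1 q.2 • e q.1 - v (a q.2) q.2 • e (a q.2)) (fun k => -e k)
    rcases farkas_alternative Finset.univ f (e i) with ⟨c, hc, h⟩ | ⟨w, hw, hwi⟩
    · exfalso
      have heq : ∀ t, ∑ j, c (.inl (t, j)) * v t j -
          ∑ j ∈ bundle a t, (∑ k, c (.inl (k, j))) * v t j =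
          (if t = i then 1 else 0) + c (.inr t) := fun t => by
        have ht := LinearMap.congr_fun h (Pi.single t 1)
        simp only [Fintype.sum_sum_type, Fintype.sum_prod_type, f, e, Sum.elim_inl, Sum.elim_inr,
          LinearMap.add_apply, LinearMap.sum_apply, LinearMap.smul_apply, LinearMap.sub_apply,
          LinearMap.neg_apply, LinearMap.proj_apply, smul_eq_mul, Pi.single_apply, mul_sub,
          Finset.sum_sub_distrib] at ht
        have h1 : ∑ k, ∑ j, c (.inl (k, j)) * (v k j * if k = t then 1 else 0) =
            ∑ j, c (.inl (t, j)) * v t j := by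
          rw [Finset.sum_comm]
          simp
        have h2 : ∑ k, ∑ j, c (.inl (k, j)) * (v (a j) j * if a j = t then 1 else 0) =
            ∑ j ∈ bundle a t, (∑ k, c (.inl (k, j))) * v t j := by
          rw [Finset.sum_comm, bundle, Finset.sum_filter]
          refine Finset.sum_congr rfl fun j _ => ?_
          split_ifs with hj <;> simp [hj, Finset.sum_mul]
        have h3 : ∑ k, c (.inr k) * -(if k = t then (1 : ℝ) else 0) = -c (.inr t) := by simp
        rw [h1, h2, h3] at ht
        simp only [eq_comm (a := t)]
        linarith
      have himp := hfpo.not_exists_improving_transfer (c := fun k j => c (.inl (k, j)))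
        (fun k j => hc _) (fun t => by
          rw [heq]
          have := hc (.inr t)
          split_ifs <;> linarith) i
      rw [heq, if_pos rfl] at himp
      linarith [hc (.inr i)]
    · refine ⟨w, fun k => ?_, hwi, fun k j => ?_⟩
      · simpa [f, e] using hw (.inr k) (Finset.mem_univ _)
      · have := hw (.inl (k, j)) (Finset.mem_univ _)
        simp only [f, e, Sum.elim_inl, LinearMap.sub_apply, LinearMap.smul_apply,
          LinearMap.proj_apply, smul_eq_mul] at this
        linarith
  choose W hW0 hWpos hW using key
  refine ⟨fun k => ∑ i, W i k, fun k => ?_, fun k j => ?_⟩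
  · exact Finset.sum_pos' (fun i _ => hW0 i k) ⟨k, Finset.mem_univ k, hWpos k⟩
  · simp only [Finset.sum_mul]
    exact Finset.sum_le_sum fun i _ => hW i k j

/-- Second welfare theorem for Fisher markets: any fractionally Pareto efficient integral
allocation admits positive prices under which every agent's bundle consists of its maximum
bang-per-buck goods; setting each agent's endowment to its spending, `(x, p)` is then a
market equilibrium (market clearing and budget exhaustion hold by construction). -/
theorem second_welfare_theorem (n m : ℕ)
    (v : Fin n → Fin m → ℝ) (hv : ∀ i j, 0 ≤ v i j)
    (hgood : ∀ j : Fin m, ∃ i : Fin n, 0 < v i j)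
    (hagent : ∀ i : Fin n, ∃ j : Fin m, 0 < v i j)
    (a : Fin m → Fin n) (hfpo : fPOR v a) :
    ∃ p : Fin m → ℝ, (∀ j, 0 < p j) ∧
      (∀ i : Fin n, ∀ j ∈ bundle a i, ∀ k : Fin m, v i k / p k ≤ v i j / p j) ∧
      -- market clearing: every good is fully (integrally) allocated or priced zero
      (∀ j : Fin m, p j = 0 ∨ ∃ i : Fin n, j ∈ bundle a i) ∧
      -- budget exhaustion with endowments `e i = p(x_i)`
      (∀ i : Fin n, (∑ j ∈ bundle a i, p j) = ∑ j ∈ bundle a i, p j) := by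
  obtain ⟨w, hw, hmax⟩ := hfpo.exists_pos_weights
  have hp : ∀ j, 0 < w (a j) * v (a j) j := fun j => by
    obtain ⟨i, hi⟩ := hgood j
    exact (mul_pos (hw i) hi).trans_le (hmax i j)
  refine ⟨fun j => w (a j) * v (a j) j, hp, fun i j hj k => ?_,
    fun j => Or.inr ⟨a j, by simp [bundle]⟩, fun _ => rfl⟩
  obtain rfl : a j = i := by simpa [bundle] using hj
  rw [div_le_div_iff₀ (hp k) (hp j)]
  have := mul_le_mul_of_nonneg_right (hmax (a j) k) (hv (a j) j)
  linarith
end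

section
/- Let I be a fair division instance in which all n agents share the same additive nonnegative valuation v, with m ≥ n goods, and let B be a subset of the goods with |B| < n. Then there exists a partially-fractional allocation ω = (ω_1,…,ω_n) ∈ ℱ_B that maximizes the Nash social welfare over ℱ_B and satisfies: (1) for every agent i, at most one good of B is assigned (with positive fraction) to i; and (2) every agent i with v(ω_i) > min_k v(ω_k) receives exactly one good, integrally, and that good belongs to B (i.e., ω_{i,j} = 1 for some j ∈ B and ω_{i,j'} = 0 for all j' ≠ j). -/
open Finset

/-- A partially-fractional allocation w.r.t. `B`: every good of `B` is integrally assigned. -/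
def InFB {n m : ℕ} (B : Finset (Fin m)) (y : Fin n → Fin m → ℝ) : Prop :=
  IsFracAlloc y ∧ ∀ i : Fin n, ∀ j ∈ B, y i j = 0 ∨ y i j = 1

/-- Nash social welfare of a fractional allocation, identical valuation `v`. -/
noncomputable def fNSW {n m : ℕ} (v : Fin m → ℝ) (y : Fin n → Fin m → ℝ) : ℝ :=
  (∏ i : Fin n, ∑ j : Fin m, y i j * v j) ^ ((n : ℝ)⁻¹)

/-- Sums of numbers at least `1` are bounded by their product, up to an exponential factor. -/
theorem sum_add_le_prod_mul_exp {ι : Type*} (K : Finset ι) (a : ι → ℝ) (ha : ∀ j ∈ K, 1 ≤ a j)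
    {r : ℝ} (hr : 0 ≤ r) :
    ∑ j ∈ K, a j + r ≤ (∏ j ∈ K, a j) * Real.exp (r + K.card - 1) := by
  classical
  have hP : 1 ≤ ∏ j ∈ K, a j := by
    simpa using Finset.prod_le_prod (s := K) (f := fun _ => (1 : ℝ)) (g := a)
      (fun _ _ => zero_le_one) ha
  have hle : ∀ j ∈ K, a j ≤ ∏ j ∈ K, a j := by
    intro j hj
    rw [← Finset.mul_prod_erase K a hj]
    have h1 : 1 ≤ ∏ i ∈ K.erase j, a i := by
      simpa using Finset.prod_le_prod (s := K.erase j) (f := fun _ => (1 : ℝ)) (g := a)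
        (fun _ _ => zero_le_one) (fun i hi => ha i (Finset.mem_of_mem_erase hi))
    nlinarith [ha j hj]
  have hsum := Finset.sum_le_card_nsmul K a _ hle
  rw [nsmul_eq_mul] at hsum
  have hexp := Real.add_one_le_exp (r + K.card - 1)
  nlinarith

/-- The scaled form of `sum_add_le_prod_mul_exp`, with all summands compared to a level `t`. -/
theorem sum_add_le_level_mul_prod_mul_exp {ι : Type*} (K : Finset ι) (v : ι → ℝ) {t : ℝ}
    (ht : 0 < t) (hv : ∀ j ∈ K, t ≤ v j) {r : ℝ} (hr : 0 ≤ r) :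
    ∑ j ∈ K, v j + r ≤
      t * ((∏ j ∈ K, v j / t) *
        Real.exp ((∑ j ∈ K, v j + r - ∑ j ∈ K, (v j - t)) / t - 1)) := by
  have h := sum_add_le_prod_mul_exp K (fun j => v j / t)
    (fun j hj => (one_le_div ht).2 (hv j hj)) (div_nonneg hr ht.le)
  have hexp : (∑ j ∈ K, v j + r - ∑ j ∈ K, (v j - t)) / t - 1 = r / t + K.card - 1 := by
    rw [Finset.sum_sub_distrib, Finset.sum_const, nsmul_eq_mul]
    field_simp
    ring
  rw [hexp]
  have h2 := mul_le_mul_of_nonneg_left h ht.le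
  rw [← Finset.sum_div] at h2
  calc ∑ j ∈ K, v j + r = t * ((∑ j ∈ K, v j) / t + r / t) := by field_simp
    _ ≤ _ := h2

/-- A level `t` at which raising all bundles below `t` up to `t` uses exactly the amount `S`. -/
theorem exists_water_level {α : Type*} [Fintype α] {b : α → ℝ} (hb : ∀ i, 0 ≤ b i) {i₀ : α} (hi₀ : b i₀ = 0) {S : ℝ}
    (hS : 0 ≤ S) : ∃ t, 0 ≤ t ∧ ∑ i, max 0 (t - b i) = S := by
  have hcont : ContinuousOn (fun t : ℝ => ∑ i, max 0 (t - b i)) (Set.Icc 0 S) := by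
    fun_prop
  have h0 : ∑ i, max 0 (0 - b i) = 0 :=
    Finset.sum_eq_zero fun i _ => max_eq_left (by linarith [hb i])
  have hS' : S ≤ ∑ i, max 0 (S - b i) := by
    have h := Finset.single_le_sum (f := fun i => max 0 (S - b i))
      (fun i _ => le_max_left _ _) (Finset.mem_univ i₀)
    simp only [hi₀, sub_zero] at h
    exact (le_max_right _ _).trans h
  obtain ⟨t, ht, hts⟩ := intermediate_value_Icc hS hcont ⟨by simpa only [h0] using hS, hS'⟩
  exact ⟨t, ht.1, hts⟩

section WaterFilling

variable {α ι : Type*} [DecidableEq α]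

/-- The total value of the goods of `B` sent to agent `i` by `σ`. -/
def bundleValue (B : Finset ι) (v : ι → ℝ) (σ : ι → α) (i : α) : ℝ :=
  ∑ j ∈ B with σ j = i, v j

theorem bundleValue_nonneg {B : Finset ι} {v : ι → ℝ} (hv : ∀ j, 0 ≤ v j) (σ : ι → α) (i : α) :
    0 ≤ bundleValue B v σ i :=
  Finset.sum_nonneg fun j _ => hv j

theorem bundleValue_eq_zero {B : Finset ι} {v : ι → ℝ} {σ : ι → α} {i : α}
    (hi : ∀ j ∈ B, σ j ≠ i) : bundleValue B v σ i = 0 := by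
  rw [bundleValue, Finset.filter_false_of_mem hi, Finset.sum_empty]

theorem bundleValue_apply {B : Finset ι} {v : ι → ℝ} {σ : ι → α} (hσ : Set.InjOn σ B) {j : ι}
    (hj : j ∈ B) : bundleValue B v σ (σ j) = v j := by
  have : B.filter (fun j' => σ j' = σ j) = {j} := by
    ext j'
    simp only [Finset.mem_filter, Finset.mem_singleton]
    constructor
    · rintro ⟨h1, h2⟩
      exact hσ h1 hj h2
    · rintro rfl
      exact ⟨hj, rfl⟩
  rw [bundleValue, this, Finset.sum_singleton]

variable [Fintype α]

theorem sum_bundleValue (B : Finset ι) (v : ι → ℝ) (σ : ι → α) :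
    ∑ i, bundleValue B v σ i = ∑ j ∈ B, v j :=
  Finset.sum_fiberwise B σ v

/-- The water-filling profile of one good per agent has the largest product among all profiles
that distribute the same goods and at most the same amount of divisible value. -/
theorem prod_bundleValue_add_le (B : Finset ι) {v : ι → ℝ} (hv : ∀ j, 0 ≤ v j) {σ : ι → α}
    (hσ : Set.InjOn σ B) (τ : ι → α) {f : α → ℝ} (hf : ∀ i, 0 ≤ f i) {t : ℝ} (ht : 0 < t)
    (hft : ∑ i, f i ≤ ∑ i, max 0 (t - bundleValue B v σ i)) :
    ∏ i, (bundleValue B v τ i + f i) ≤ ∏ i, max (bundleValue B v σ i) t := by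
  classical
  set H := B.filter (fun j => t < v j) with hH
  have himage : ∀ i ∉ B.image σ, max (bundleValue B v σ i) t = t := by
    intro i hi
    rw [bundleValue_eq_zero fun j hj h => hi (Finset.mem_image.2 ⟨j, hj, h⟩)]
    exact max_eq_right ht.le
  have hsumH : ∑ i, (max (bundleValue B v σ i) t - t) = ∑ j ∈ H, (v j - t) := by
    rw [← Finset.sum_subset (Finset.subset_univ (B.image σ))
      (fun i _ hi => by rw [himage i hi, sub_self]), Finset.sum_image hσ, hH, Finset.sum_filter]
    refine Finset.sum_congr rfl fun j hj => ?_
    rw [bundleValue_apply hσ hj]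
    split_ifs with h
    · rw [max_eq_left h.le]
    · rw [max_eq_right (not_lt.1 h), sub_self]
  have hprodH : ∏ i, (max (bundleValue B v σ i) t / t) = ∏ j ∈ H, v j / t := by
    rw [← Finset.prod_subset (Finset.subset_univ (B.image σ))
      (fun i _ hi => by rw [himage i hi, div_self ht.ne']), Finset.prod_image hσ, hH,
      Finset.prod_filter]
    refine Finset.prod_congr rfl fun j hj => ?_
    rw [bundleValue_apply hσ hj]
    split_ifs with h
    · rw [max_eq_left h.le]
    · rw [max_eq_right (not_lt.1 h), div_self ht.ne']
  have hagent : ∀ i, bundleValue B v τ i + f i ≤ t * ((∏ j ∈ H with τ j = i, v j / t) *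
      Real.exp ((bundleValue B v τ i + f i - ∑ j ∈ H with τ j = i, (v j - t)) / t - 1)) := by
    intro i
    have hsub : ∑ j ∈ H with τ j = i, v j ≤ bundleValue B v τ i :=
      Finset.sum_le_sum_of_subset_of_nonneg
        (Finset.filter_subset_filter _ (Finset.filter_subset _ _)) fun j _ _ => hv j
    have h := sum_add_le_level_mul_prod_mul_exp (H.filter fun j => τ j = i) v ht
      (fun j hj => (Finset.mem_filter.1 (Finset.mem_filter.1 hj).1).2.le)
      (r := bundleValue B v τ i + f i - ∑ j ∈ H with τ j = i, v j)
      (by linarith [hf i])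
    simpa only [add_sub_cancel] using h
  have hexponent : ∑ i, ((bundleValue B v τ i + f i -
      ∑ j ∈ H with τ j = i, (v j - t)) / t - 1) ≤ 0 := by
    have hmax : ∀ i, max (bundleValue B v σ i) t =
        bundleValue B v σ i + max 0 (t - bundleValue B v σ i) := fun i => by
      rw [← max_add_add_left, add_zero, add_sub_cancel]
    have hfib := Finset.sum_fiberwise H τ (fun j => v j - t)
    rw [Finset.sum_sub_distrib] at hsumH
    simp only [hmax, Finset.sum_add_distrib, sum_bundleValue] at hsumH
    rw [Finset.sum_sub_distrib, ← Finset.sum_div, Finset.sum_sub_distrib,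
      Finset.sum_add_distrib, sum_bundleValue, hfib, sub_nonpos, div_le_iff₀ ht]
    have hone : (∑ _i : α, (1 : ℝ)) * t = ∑ _i : α, t := by
      rw [Finset.sum_mul, one_mul]
    linarith
  calc ∏ i, (bundleValue B v τ i + f i)
      ≤ ∏ i, (t * ((∏ j ∈ H with τ j = i, v j / t) *
          Real.exp ((bundleValue B v τ i + f i -
            ∑ j ∈ H with τ j = i, (v j - t)) / t - 1))) :=
        Finset.prod_le_prod (fun i _ => add_nonneg (bundleValue_nonneg hv τ i) (hf i))
          fun i _ => hagent i
    _ = (∏ _i : α, t) * ((∏ j ∈ H, v j / t) *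
          Real.exp (∑ i, ((bundleValue B v τ i + f i -
            ∑ j ∈ H with τ j = i, (v j - t)) / t - 1))) := by
        rw [Finset.prod_mul_distrib, Finset.prod_mul_distrib, ← Real.exp_sum,
          Finset.prod_fiberwise H τ (fun j => v j / t)]
    _ ≤ (∏ _i : α, t) * ∏ j ∈ H, v j / t := by
        refine mul_le_mul_of_nonneg_left ?_ (Finset.prod_nonneg fun _ _ => ht.le)
        exact mul_le_of_le_one_right
          (Finset.prod_nonneg fun j _ => div_nonneg (hv j) ht.le) (Real.exp_le_one_iff.2 hexponent)
    _ = ∏ i, max (bundleValue B v σ i) t := by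
        rw [← hprodH, ← Finset.prod_mul_distrib]
        exact Finset.prod_congr rfl fun i _ => mul_div_cancel₀ _ ht.ne'

end WaterFilling

/-- Fewer goods than agents can be sent to distinct agents, leaving out some agent. -/
theorem exists_injOn_and_forall_ne {α ι : Type*} [Fintype α] (B : Finset ι)
    (hB : B.card < Fintype.card α) :
    ∃ σ : ι → α, Set.InjOn σ B ∧ ∃ i₀, ∀ j ∈ B, σ j ≠ i₀ := by
  classical
  obtain ⟨e⟩ : Nonempty (B ↪ α) :=
    Function.Embedding.nonempty_of_card_le (by simpa using hB.le)
  have : Nonempty α := Fintype.card_pos_iff.1 (by omega)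
  refine ⟨fun j => if h : j ∈ B then e ⟨j, h⟩ else Classical.arbitrary α, ?_, ?_⟩
  · intro j hj j' hj' h
    rw [Finset.mem_coe] at hj hj'
    simpa [hj, hj'] using h
  · obtain ⟨i₀, -, hi₀⟩ := Finset.exists_mem_notMem_of_card_lt_card
      (s := B.image fun j => if h : j ∈ B then e ⟨j, h⟩ else Classical.arbitrary α)
      (t := Finset.univ) (Finset.card_image_le.trans_lt (by simpa using hB))
    exact ⟨i₀, fun j hj h => hi₀ (Finset.mem_image.2 ⟨j, hj, h⟩)⟩

/-- The values of a partially-fractional allocation are dominated by a complete assignment of the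
goods of `B` plus the shares of the other goods. -/
theorem InFB.exists_value_le {n m : ℕ} (hn : 0 < n) {v : Fin m → ℝ} (hv : ∀ j, 0 ≤ v j)
    {B : Finset (Fin m)} {y : Fin n → Fin m → ℝ} (hy : InFB B y) :
    ∃ τ : Fin m → Fin n, ∀ i,
      ∑ j, y i j * v j ≤ bundleValue B v τ i + ∑ j ∈ Bᶜ, y i j * v j := by
  classical
  obtain ⟨⟨hy0, -, hy1⟩, hint⟩ := hy
  refine ⟨fun j => if h : ∃ i, y i j = 1 then h.choose else ⟨0, hn⟩, fun i => ?_⟩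
  rw [← Finset.sum_add_sum_compl B, bundleValue, Finset.sum_filter]
  refine add_le_add_left (Finset.sum_le_sum fun j hj => ?_) _
  rcases hint i j hj with h0 | h1
  · rw [h0, zero_mul]
    split_ifs <;> first | exact hv j | exact le_rfl
  · have hex : ∃ i, y i j = 1 := ⟨i, h1⟩
    have hi : hex.choose = i := by
      by_contra hne
      have h := Finset.sum_le_sum_of_subset_of_nonneg (f := fun k => y k j)
        (Finset.subset_univ {hex.choose, i}) fun k _ _ => hy0 k j
      rw [Finset.sum_pair hne, h1, hex.choose_spec] at h
      linarith [hy1 j]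
    rw [dif_pos hex, if_pos hi, h1, one_mul]

theorem IsFracAlloc.sum_share_le {n m : ℕ} {v : Fin m → ℝ} (hv : ∀ j, 0 ≤ v j)
    {y : Fin n → Fin m → ℝ} (hy : IsFracAlloc y) (C : Finset (Fin m)) :
    ∑ i, ∑ j ∈ C, y i j * v j ≤ ∑ j ∈ C, v j := by
  rw [Finset.sum_comm]
  refine Finset.sum_le_sum fun j _ => ?_
  rw [← Finset.sum_mul]
  exact mul_le_of_le_one_left (hv j) (hy.2.2 j)

/-- If `B` has fewer goods than there are agents, some agent gets nothing from `B`. -/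
theorem exists_bundleValue_eq_zero {α ι : Type*} [DecidableEq α] [Fintype α] (B : Finset ι)
    (hB : B.card < Fintype.card α) (v : ι → ℝ) (τ : ι → α) : ∃ i, bundleValue B v τ i = 0 := by
  obtain ⟨i, -, hi⟩ := Finset.exists_mem_notMem_of_card_lt_card
    (s := B.image τ) (t := Finset.univ) (Finset.card_image_le.trans_lt (by simpa using hB))
  exact ⟨i, bundleValue_eq_zero fun j hj h => hi (Finset.mem_image.2 ⟨j, hj, h⟩)⟩

/-- Send the goods of `B` to agents along `σ`; give agent `i` the share `s i` of every other
good. -/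
def shareAlloc {n m : ℕ} (B : Finset (Fin m)) (σ : Fin m → Fin n) (s : Fin n → ℝ) :
    Fin n → Fin m → ℝ :=
  fun i j => if j ∈ B then (if σ j = i then 1 else 0) else s i

theorem inFB_shareAlloc {n m : ℕ} (B : Finset (Fin m)) (σ : Fin m → Fin n) {s : Fin n → ℝ}
    (hs : ∀ i, 0 ≤ s i) (hs1 : ∑ i, s i ≤ 1) : InFB B (shareAlloc B σ s) := by
  have h0 : ∀ i j, 0 ≤ shareAlloc B σ s i j := by
    intro i j
    unfold shareAlloc
    split_ifs
    exacts [zero_le_one, le_rfl, hs i]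
  have h1 : ∀ j, ∑ i, shareAlloc B σ s i j ≤ 1 := by
    intro j
    by_cases hj : j ∈ B
    · simp [shareAlloc, hj]
    · simpa [shareAlloc, hj] using hs1
  refine ⟨⟨h0, fun i j => ?_, h1⟩, fun i j hj => ?_⟩
  · exact (Finset.single_le_sum (f := fun i => shareAlloc B σ s i j) (fun i _ => h0 i j)
      (Finset.mem_univ i)).trans (h1 j)
  · by_cases h : σ j = i <;> simp [shareAlloc, hj, h]

theorem value_shareAlloc {n m : ℕ} (B : Finset (Fin m)) (σ : Fin m → Fin n) (s : Fin n → ℝ)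
    (v : Fin m → ℝ) (i : Fin n) :
    ∑ j, shareAlloc B σ s i j * v j = bundleValue B v σ i + s i * ∑ j ∈ Bᶜ, v j := by
  rw [← Finset.sum_add_sum_compl B, bundleValue, Finset.sum_filter, Finset.mul_sum]
  congr 1
  · exact Finset.sum_congr rfl fun j hj => by simp [shareAlloc, hj]
  · exact Finset.sum_congr rfl fun j hj => by simp [shareAlloc, Finset.mem_compl.1 hj]

/-- Structure of NSW maximizers over partially-fractional allocations with respect to a set
`B` of fewer than `n` goods, under identical additive nonnegative valuations with `m ≥ n`:
some maximizer assigns at most one good of `B` to each agent, and every agent whose value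
exceeds the minimum receives exactly one good, integrally, and that good is in `B`. -/
theorem nash_opt_structure (n m : ℕ) (hn : 0 < n) (hm : n ≤ m)
    (v : Fin m → ℝ) (hv : ∀ j, 0 ≤ v j)
    (B : Finset (Fin m)) (hB : B.card < n) :
    ∃ ω : Fin n → Fin m → ℝ, InFB B ω ∧
      (∀ y : Fin n → Fin m → ℝ, InFB B y → fNSW v y ≤ fNSW v ω) ∧
      (∀ i : Fin n, (B.filter (fun j => 0 < ω i j)).card ≤ 1) ∧
      (∀ i : Fin n, (∃ k : Fin n, (∑ j, ω k j * v j) < ∑ j, ω i j * v j) →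
        ∃ j ∈ B, ω i j = 1 ∧ ∀ j' : Fin m, j' ≠ j → ω i j' = 0) := by
  have hBn : B.card < Fintype.card (Fin n) := by rwa [Fintype.card_fin]
  obtain ⟨σ, hσ, i₀, hi₀⟩ := exists_injOn_and_forall_ne (α := Fin n) B hBn
  have hb := bundleValue_nonneg (B := B) hv σ
  set S := ∑ j ∈ Bᶜ, v j with hS
  have hS0 : 0 ≤ S := Finset.sum_nonneg fun j _ => hv j
  obtain ⟨t, ht, hlevel⟩ := exists_water_level hb (bundleValue_eq_zero hi₀) hS0
  set s : Fin n → ℝ := fun i => max 0 (t - bundleValue B v σ i) / S with hs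
  have hs0 : ∀ i, 0 ≤ s i := fun i => div_nonneg (le_max_left _ _) hS0
  have hs1 : ∑ i, s i ≤ 1 := by
    rw [hs, ← Finset.sum_div, hlevel]
    exact div_self_le_one S
  have hval : ∀ i, ∑ j, shareAlloc B σ s i j * v j = max (bundleValue B v σ i) t := by
    intro i
    have hle := Finset.single_le_sum (f := fun i => max 0 (t - bundleValue B v σ i))
      (fun i _ => le_max_left _ _) (Finset.mem_univ i)
    rw [hlevel] at hle
    have hmul : s i * S = max 0 (t - bundleValue B v σ i) :=
      div_mul_cancel_of_imp fun h => le_antisymm (h ▸ hle) (le_max_left _ _)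
    rw [value_shareAlloc, ← hS, hmul, ← max_add_add_left, add_zero, add_sub_cancel]
  have hω := inFB_shareAlloc B σ hs0 hs1
  refine ⟨shareAlloc B σ s, hω, fun y hy => ?_, fun i => ?_, fun i ⟨k, hk⟩ => ?_⟩
  · have hy0 : ∀ i, 0 ≤ ∑ j, y i j * v j := fun i =>
      Finset.sum_nonneg fun j _ => mul_nonneg (hy.1.1 i j) (hv j)
    refine Real.rpow_le_rpow (Finset.prod_nonneg fun i _ => hy0 i) ?_
      (inv_nonneg.2 (Nat.cast_nonneg n))
    obtain ⟨τ, hτ⟩ := hy.exists_value_le hn hv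
    have hf : ∀ i, 0 ≤ ∑ j ∈ Bᶜ, y i j * v j := fun i =>
      Finset.sum_nonneg fun j _ => mul_nonneg (hy.1.1 i j) (hv j)
    have hfS := hy.1.sum_share_le hv Bᶜ
    simp only [hval]
    rcases ht.eq_or_lt with rfl | htpos
    · obtain ⟨i, hi⟩ := exists_bundleValue_eq_zero B hBn v τ
      have hSz : S = 0 := hlevel.symm.trans
        (Finset.sum_eq_zero fun i _ => max_eq_left (by linarith [hb i]))
      have hfi := (Finset.single_le_sum (fun i _ => hf i) (Finset.mem_univ i)).trans hfS
      have hzero : ∑ j, y i j * v j = 0 := le_antisymm (by linarith [hτ i]) (hy0 i)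
      rw [Finset.prod_eq_zero (Finset.mem_univ i) hzero]
      exact Finset.prod_nonneg fun i _ => le_max_right _ _
    · exact (Finset.prod_le_prod (fun i _ => hy0 i) fun i _ => hτ i).trans
        (prod_bundleValue_add_le B hv hσ τ hf htpos (hlevel ▸ hfS))
  · have howner : ∀ j ∈ B.filter (fun j => 0 < shareAlloc B σ s i j), j ∈ B ∧ σ j = i := by
      intro j hj
      obtain ⟨hjB, hpos⟩ := Finset.mem_filter.1 hj
      refine ⟨hjB, ?_⟩
      by_contra h
      simp [shareAlloc, hjB, h] at hpos
    refine Finset.card_le_one.2 fun j hj j' hj' => ?_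
    exact hσ (howner j hj).1 (howner j' hj').1 ((howner j hj).2.trans (howner j' hj').2.symm)
  · rw [hval, hval] at hk
    have hti : t < bundleValue B v σ i := by
      by_contra h
      rw [max_eq_right (not_lt.1 h)] at hk
      exact absurd hk (not_lt.2 (le_max_right _ _))
    obtain ⟨j, hj, rfl⟩ : ∃ j ∈ B, σ j = i := by
      by_contra! h
      rw [bundleValue_eq_zero h] at hti
      exact absurd ht (not_le.2 hti)
    refine ⟨j, hj, by simp [shareAlloc, hj], fun j' hne => ?_⟩
    by_cases hj' : j' ∈ B
    · have : σ j' ≠ σ j := fun h => hne (hσ hj' hj h)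
      simp [shareAlloc, hj', this]
    · simp [shareAlloc, hj', hs, hti.le]
end

section
/- Fix reals c > 0 and 0 < δ < 1/3, and consider the fair division instance with 3 agents and 5 goods {h_1, h_2, g_1, g_2, g_3}, where every agent values h_1 and h_2 at c each, agent i values its signature good g_i at 1/3, and agent i values g_j at 1/3 − δ for j ≠ i. Then every integral allocation x that is fractionally Pareto efficient for this instance has some agent i ∈ {1,2,3} with x_i ⊆ {g_i}. -/
open Finset

/-- The instance with 3 agents and 5 goods: goods `0, 1` are the high-valued goods `h₁, h₂`
(valued at `c` by everyone); good `i + 2` is the signature good `g_{i+1}` (valued at `1/3`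
by agent `i` and at `1/3 - δ` by the other agents). -/
noncomputable def sigVal (c δ : ℝ) : Fin 3 → Fin 5 → ℝ := fun i j =>
  if j.val < 2 then c else if j.val = i.val + 2 then 1 / 3 else 1 / 3 - δ

/-- Each agent `k` hands the fraction `q (w k)` of a good `w k` it owns to agent `σ k`. -/
noncomputable def tradeAlloc {n m : ℕ} (a : Fin m → Fin n) (σ : Equiv.Perm (Fin n))
    (w : Fin n → Fin m) (q : Fin m → ℝ) : Fin n → Fin m → ℝ := fun i j =>
  (if a j = i then 1 else 0) +
    (if w (a j) = j then q j else 0) *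
      ((if σ (a j) = i then 1 else 0) - (if a j = i then 1 else 0))

lemma isFracAlloc_tradeAlloc {n m : ℕ} (a : Fin m → Fin n) (σ : Equiv.Perm (Fin n))
    (w : Fin n → Fin m) (q : Fin m → ℝ) (hq0 : ∀ j, 0 ≤ q j) (hq1 : ∀ j, q j ≤ 1) :
    IsFracAlloc (tradeAlloc a σ w q) := by
  refine ⟨fun i j => ?_, fun i j => ?_, fun j => ?_⟩
  · have := hq0 j
    have := hq1 j
    unfold tradeAlloc
    split_ifs <;> linarith
  · have := hq0 j
    have := hq1 j
    unfold tradeAlloc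
    split_ifs <;> linarith
  · simp [tradeAlloc, Finset.sum_add_distrib, ← Finset.mul_sum]

lemma sum_tradeAlloc_mul {n m : ℕ} (v : Fin n → Fin m → ℝ) (a : Fin m → Fin n)
    (σ : Equiv.Perm (Fin n)) (w : Fin n → Fin m) (hw : ∀ k, a (w k) = k) (q : Fin m → ℝ)
    (k : Fin n) :
    ∑ j, tradeAlloc a σ w q (σ k) j * v (σ k) j =
      ∑ j ∈ bundle a (σ k), v (σ k) j +
        (q (w k) * v (σ k) (w k) - q (w (σ k)) * v (σ k) (w (σ k))) := by
  have hinj : Function.Injective w := Function.LeftInverse.injective hw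
  have hsum : ∑ l, q (w l) * ((if σ l = σ k then 1 else 0) - (if l = σ k then 1 else 0)) *
        v (σ k) (w l) =
      ∑ j, (if w (a j) = j then q j else 0) *
        ((if σ (a j) = σ k then 1 else 0) - (if a j = σ k then 1 else 0)) * v (σ k) j := by
    refine Finset.sum_of_injOn w hinj.injOn (by simp) (fun j _ hj => ?_) (fun l _ => ?_)
    · have : w (a j) ≠ j := fun h => hj ⟨a j, by simp, h⟩
      simp [this]
    · simp [hw]
  simp only [tradeAlloc, add_mul, Finset.sum_add_distrib, ← hsum]
  congr 1
  · simp [bundle, Finset.sum_filter]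
  · simp [mul_sub, sub_mul, Finset.sum_sub_distrib]

/-- A trade that harms no agent and benefits some agent rules out fractional Pareto efficiency. -/
lemma not_fPOR_of_trade {n m : ℕ} {v : Fin n → Fin m → ℝ} {a : Fin m → Fin n}
    (σ : Equiv.Perm (Fin n)) (w : Fin n → Fin m) (hw : ∀ k, a (w k) = k) (q : Fin m → ℝ)
    (hq0 : ∀ j, 0 ≤ q j) (hq1 : ∀ j, q j ≤ 1)
    (hle : ∀ k, q (w (σ k)) * v (σ k) (w (σ k)) ≤ q (w k) * v (σ k) (w k))
    (hlt : ∃ k, q (w (σ k)) * v (σ k) (w (σ k)) < q (w k) * v (σ k) (w k)) :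
    ¬ fPOR v a := by
  refine not_not.mpr ⟨tradeAlloc a σ w q, isFracAlloc_tradeAlloc a σ w q hq0 hq1, fun i => ?_, ?_⟩
  · obtain ⟨k, rfl⟩ := σ.surjective i
    rw [sum_tradeAlloc_mul v a σ w hw]
    linarith [hle k]
  · obtain ⟨k, hk⟩ := hlt
    refine ⟨σ k, ?_⟩
    rw [sum_tradeAlloc_mul v a σ w hw]
    linarith

/-- A fixed-point-free self-map of `Fin 3` has a nontrivial cycle. -/
lemma exists_perm_of_forall_ne (f : Fin 3 → Fin 3) (hf : ∀ i, f i ≠ i) :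
    ∃ σ : Equiv.Perm (Fin 3), (∃ i, σ i ≠ i) ∧ ∀ i, σ i ≠ i → σ i = f i := by
  revert f
  decide


/-- In the signature-goods instance, every fractionally Pareto efficient integral allocation
has some agent receiving at most its own signature good. -/
theorem fpo_signature_instance (c δ : ℝ) (hc : 0 < c) (hδ0 : 0 < δ) (hδ : δ < 1 / 3)
    (a : Fin 5 → Fin 3) (hfpo : fPOR (sigVal c δ) a) :
    ∃ i : Fin 3, bundle a i ⊆ {⟨i.val + 2, by have := i.isLt; omega⟩} := by
  by_contra! hne
  have hex : ∀ i : Fin 3, ∃ j : Fin 5, a j = i ∧ j.val ≠ i.val + 2 := by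
    intro i
    obtain ⟨j, hj, hji⟩ := Finset.not_subset.mp (hne i)
    refine ⟨j, by simpa [bundle] using hj, fun h => hji ?_⟩
    simp [Fin.ext_iff, h]
  choose w hw hsig using hex
  obtain ⟨i₀, h0, h1⟩ : ∃ i₀, a 0 ≠ i₀ ∧ a 1 ≠ i₀ := by
    generalize a 0 = x
    generalize a 1 = y
    revert x y
    decide
  have hlow : ∀ k, (w k).val < 2 → k ≠ i₀ := by
    rintro k hk rfl
    have hcases : w k = 0 ∨ w k = 1 := by
      simp only [Fin.ext_iff]
      norm_num
      omega
    rcases hcases with h | h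
    · exact h0 (h ▸ hw k)
    · exact h1 (h ▸ hw k)
  obtain ⟨σ, ⟨k₁, hk₁⟩, hσ⟩ := exists_perm_of_forall_ne
    (fun k => if (w k).val < 2 then i₀ else ⟨(w k).val - 2, by omega⟩) (by
      intro k
      have := hsig k
      split_ifs with h
      · exact (hlow k h).symm
      · simp only [ne_eq, Fin.ext_iff]
        omega)
  obtain ⟨s, hs0, hs1, hsc⟩ : ∃ s : ℝ, 0 < s ∧ s ≤ 1 ∧ s * (1 / 3 - δ) ≤ c := by
    refine ⟨min 1 c, lt_min one_pos hc, min_le_left _ _, ?_⟩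
    nlinarith [min_le_right 1 c, lt_min one_pos hc]
  have hδ' : 0 < 1 / 3 - δ := by linarith
  let q : Fin 5 → ℝ := fun j => if j.val < 2 then s * (1 / 3 - δ) / c else s
  have hown : ∀ k, q (w k) * sigVal c δ k (w k) = s * (1 / 3 - δ) := by
    intro k
    simp only [q, sigVal, if_neg (hsig k)]
    split_ifs
    · field_simp
    · rfl
  have hhigh : ∀ k i, (w k).val < 2 → q (w k) * sigVal c δ i (w k) = s * (1 / 3 - δ) := by
    intro k i h
    simp only [q, sigVal, if_pos h]
    field_simp
  have hsignature : ∀ k, σ k ≠ k → ¬ (w k).val < 2 →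
      q (w k) * sigVal c δ (σ k) (w k) = s * (1 / 3) := by
    intro k hk h
    have hk' := hσ k hk
    rw [if_neg h, Fin.ext_iff] at hk'
    have : (w k).val = (σ k).val + 2 := by
      simp only at hk'
      omega
    simp only [q, sigVal, if_neg h, if_pos this]
  refine not_fPOR_of_trade σ w hw q (fun j => ?_) (fun j => ?_) (fun k => ?_) ?_ hfpo
  · simp only [q]
    split_ifs <;> positivity
  · simp only [q]
    split_ifs
    · exact (div_le_one hc).mpr hsc
    · exact hs1
  · by_cases hk : σ k = k
    · rw [hk]
    rw [hown]
    by_cases h : (w k).val < 2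
    · rw [hhigh k _ h]
    · rw [hsignature k hk h]
      nlinarith
  · obtain ⟨k, hk, h⟩ : ∃ k, σ k ≠ k ∧ ¬ (w k).val < 2 := by
      by_cases hi : σ i₀ = i₀
      · refine ⟨k₁, hk₁, fun h => hk₁ ?_⟩
        have hk' := hσ k₁ hk₁
        rw [if_pos h] at hk'
        exact absurd (σ.injective (hk'.trans hi.symm)) (hlow k₁ h)
      · exact ⟨i₀, hi, fun h => hlow i₀ h rfl⟩
    refine ⟨k, ?_⟩
    rw [hown, hsignature k hk h]
    nlinarith
end

section
/- There exists a fair division instance with additive nonnegative real valuations such that every integral allocation x that is fractionally Pareto efficient satisfies 1.44 · NSW(x) ≤ NSW(x*), where x* is a Nash optimal allocation; that is, the best Nash social welfare achievable by a fractionally Pareto efficient integral allocation can be at least a factor 1.44 below the optimum. -/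
open Finset

/-- Nash social welfare of an integral allocation (real valuations). -/
noncomputable def NSW {n m : ℕ} (v : Fin n → Fin m → ℝ) (a : Fin m → Fin n) : ℝ :=
  (∏ i : Fin n, ∑ j ∈ bundle a i, v i j) ^ ((n : ℝ)⁻¹)

/-- If the owner `a b` of good `b` values good `s` more than a fraction `δ` of `b`, while the owner
`a s` of `s` values that fraction of `b` more than `s`, then trading the two shows that the
allocation `a` is not fractionally Pareto efficient. -/
lemma not_fPOR_of_trade_s11 {n m : ℕ} (v : Fin n → Fin m → ℝ) (a : Fin m → Fin n) (b s : Fin m)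
    (δ : ℝ) (h0 : 0 ≤ δ) (h1 : δ ≤ 1) (hne : a s ≠ a b)
    (hb : δ * v (a b) b < v (a b) s) (hs : v (a s) s < δ * v (a s) b) : ¬ fPOR v a := by
  have hbs : b ≠ s := fun h => hne (by rw [h])
  let e : Fin n → ℝ := fun k => (if a b = k then 1 else 0) - (if a s = k then 1 else 0)
  let y : Fin n → Fin m → ℝ := fun k j =>
    (if a j = k then 1 else 0) + ((if s = j then e k else 0) - (if b = j then δ * e k else 0))
  have hval : ∀ k, ∑ j, y k j * v k j =
      (∑ j ∈ bundle a k, v k j) + e k * (v k s - δ * v k b) := by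
    intro k
    simp only [y, add_mul, sub_mul, Finset.sum_add_distrib, Finset.sum_sub_distrib, ite_mul,
      zero_mul, one_mul, Finset.sum_ite_eq, Finset.mem_univ, if_true, bundle, Finset.sum_filter]
    ring
  have hgain : ∀ k, a b = k → 0 < e k * (v k s - δ * v k b) := by
    rintro k rfl
    simp only [e, if_true, if_neg hne]
    linarith
  have hpos : ∀ k, 0 ≤ e k * (v k s - δ * v k b) := by
    intro k
    by_cases hkb : a b = k
    · exact (hgain k hkb).le
    · by_cases hks : a s = k
      · subst hks
        simp only [e, if_true, if_neg hkb]
        linarith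
      · simp [e, hkb, hks]
  have hy : ∀ k j, 0 ≤ y k j ∧ y k j ≤ 1 := by
    intro k j
    simp only [y, e]
    by_cases hjs : s = j
    · subst hjs
      by_cases hks : a s = k
      · have : a b ≠ k := fun h => hne (hks.trans h.symm)
        simp [hbs, hks, this]
      · by_cases hkb : a b = k <;> simp [hbs, hks, hkb]
    · by_cases hjb : b = j
      · subst hjb
        by_cases hks : a s = k
        · have : a b ≠ k := fun h => hne (hks.trans h.symm)
          simp [Ne.symm hbs, hks, this, h0, h1]
        · by_cases hkb : a b = k <;> simp [Ne.symm hbs, hks, hkb, h0, h1]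
      · by_cases hkj : a j = k <;> simp [hjs, hjb, hkj]
  have he : ∑ k, e k = 0 := by simp [e]
  have hsum : ∀ j, ∑ k, y k j ≤ 1 := by
    intro j
    have h : ∀ (p : Prop) [Decidable p] (f : Fin n → ℝ),
        ∑ k, (if p then f k else 0) = if p then ∑ k, f k else 0 := by
      intro p _ f
      split_ifs <;> simp
    simp only [y, Finset.sum_add_distrib, Finset.sum_sub_distrib, h, ← Finset.mul_sum, he]
    simp
  refine fun hf => hf ⟨y, ⟨fun k j => (hy k j).1, fun k j => (hy k j).2, hsum⟩, fun k => ?_,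
    a b, ?_⟩
  · rw [hval]
    linarith [hpos k]
  · rw [hval]
    linarith [hgain _ rfl]

/-- Three agents; goods `3` and `4` are large and valued equally by everyone, while agent `i` values
the small good `i` slightly more than the other agents do. -/
def gapValuation (i : Fin 3) (j : Fin 5) : ℕ :=
  if 3 ≤ j.val then 10000000 else if j.val = i.val then 1001 else 1000

/-- In a fractionally Pareto efficient allocation, an agent holding a large good of `gapValuation`
also holds the small good that it prefers. -/
lemma owns_small_of_owns_large (a : Fin 5 → Fin 3)
    (ha : fPOR (fun i j => (gapValuation i j : ℝ)) a) (b : Fin 5) (hb : 3 ≤ b.val) :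
    a (Fin.castLE (by norm_num) (a b)) = a b := by
  by_contra hne
  refine not_fPOR_of_trade_s11 _ a b _ (1000.5 / 10000000) (by norm_num) (by norm_num) hne ?_ ?_ ha
  · have : ¬ 3 ≤ (a b).val := by omega
    simp [gapValuation, hb, this]
    norm_num
  · have h : ¬ 3 ≤ (a b).val := by omega
    have h' : (a b).val ≠ (a (Fin.castLE (by norm_num) (a b))).val :=
      fun h => hne (Fin.ext h.symm)
    simp [gapValuation, hb, h, h']
    norm_num

lemma gapValuation_prod_le (a : Fin 5 → Fin 3) (h3 : a (Fin.castLE (by norm_num) (a 3)) = a 3)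
    (h4 : a (Fin.castLE (by norm_num) (a 4)) = a 4) :
    2985984 * ∏ i, ∑ j ∈ bundle a i, gapValuation i j ≤
      1000000 * (10000000 * 10000000 * 3001) := by
  simp only [bundle, Finset.sum_filter, Fin.sum_univ_five, Fin.prod_univ_three]
  have key : ∀ x3 x4 x0 x1 x2 : Fin 3, ![x0, x1, x2] x3 = x3 → ![x0, x1, x2] x4 = x4 →
      2985984 * (((((if x0 = 0 then gapValuation 0 0 else 0) +
        (if x1 = 0 then gapValuation 0 1 else 0)) + (if x2 = 0 then gapValuation 0 2 else 0)) +
        (if x3 = 0 then gapValuation 0 3 else 0)) + (if x4 = 0 then gapValuation 0 4 else 0)) *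
      (((((if x0 = 1 then gapValuation 1 0 else 0) +
        (if x1 = 1 then gapValuation 1 1 else 0)) + (if x2 = 1 then gapValuation 1 2 else 0)) +
        (if x3 = 1 then gapValuation 1 3 else 0)) + (if x4 = 1 then gapValuation 1 4 else 0)) *
      (((((if x0 = 2 then gapValuation 2 0 else 0) +
        (if x1 = 2 then gapValuation 2 1 else 0)) + (if x2 = 2 then gapValuation 2 2 else 0)) +
        (if x3 = 2 then gapValuation 2 3 else 0)) + (if x4 = 2 then gapValuation 2 4 else 0)) ≤
      1000000 * (10000000 * 10000000 * 3001) := by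
    decide +kernel
  have hsmall : ∀ i : Fin 3, a (Fin.castLE (by norm_num) i) = ![a 0, a 1, a 2] i := by
    intro i
    fin_cases i <;> rfl
  rw [hsmall] at h3 h4
  simpa only [mul_assoc] using key (a 3) (a 4) (a 0) (a 1) (a 2) h3 h4

/-- There is an instance in which every fractionally Pareto efficient integral allocation
falls short of the optimal Nash social welfare by a factor of at least 1.44. -/
theorem fpo_nsw_gap_exists :
    ∃ (n m : ℕ) (v : Fin n → Fin m → ℝ), 0 < n ∧ (∀ i j, 0 ≤ v i j) ∧
      ∃ xstar : Fin m → Fin n, (∀ b : Fin m → Fin n, NSW v b ≤ NSW v xstar) ∧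
        ∀ a : Fin m → Fin n, fPOR v a → 1.44 * NSW v a ≤ NSW v xstar := by
  refine ⟨3, 5, fun i j => (gapValuation i j : ℝ), by norm_num, fun i j => Nat.cast_nonneg _, ?_⟩
  obtain ⟨xstar, hx⟩ := Finite.exists_max (NSW fun i j => (gapValuation i j : ℝ))
  refine ⟨xstar, hx, fun a ha => le_trans ?_ (hx ![2, 2, 2, 0, 1])⟩
  have hcast : ∀ c : Fin 5 → Fin 3, ∏ i, ∑ j ∈ bundle c i, (gapValuation i j : ℝ) =
      ((∏ i, ∑ j ∈ bundle c i, gapValuation i j : ℕ) : ℝ) := fun c => by push_cast; rfl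
  have hle := gapValuation_prod_le a (owns_small_of_owns_large a ha 3 (by decide))
    (owns_small_of_owns_large a ha 4 (by decide))
  have hwit : ∏ i, ∑ j ∈ bundle ![2, 2, 2, 0, 1] i, gapValuation i j =
      10000000 * 10000000 * 3001 := by
    decide +kernel
  rw [← hwit] at hle
  unfold NSW
  rw [hcast, hcast]
  generalize ∏ i, ∑ j ∈ bundle a i, gapValuation i j = p at hle
  generalize ∏ i, ∑ j ∈ bundle ![2, 2, 2, 0, 1] i, gapValuation i j = q at hle
  have hle' : (2985984 : ℝ) * p ≤ 1000000 * q := by exact_mod_cast hle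
  have hroot : (1.44 : ℝ) = ((1.44 : ℝ) ^ 3) ^ (((3 : ℕ) : ℝ)⁻¹) :=
    (Real.pow_rpow_inv_natCast (by norm_num) (by norm_num)).symm
  rw [hroot, ← Real.mul_rpow (by positivity) (by positivity)]
  refine Real.rpow_le_rpow (by positivity) ?_ (by positivity)
  norm_num
  linarith
end

section
/- For every n ≥ 2, consider the fair division instance with n agents and m = 2n goods where every agent values each good j ∈ {1,…,2n−2} at 2^{n−1}, agents 1,…,n−1 value goods 2n−1 and 2n at 0, and agent n values good 2n−1 at 1 and good 2n at 2^n − 1. The allocation y with y_1 = {1,2,2n}, y_i = {2i−1,2i} for 2 ≤ i ≤ n−1, and y_n = {2n−1} satisfies 2·NSW(y) ≥ NSW(x*) for a Nash optimal allocation x* (indeed NSW(y) = 2^{n−1} and NSW(x*) = 2^n), yet y is neither EF1 nor Pareto efficient. -/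
open Finset

/-- Envy-freeness up to one good (real valuations). -/
def EF1R {n m : ℕ} (v : Fin n → Fin m → ℝ) (a : Fin m → Fin n) : Prop :=
  ∀ i k : Fin n, (∑ j ∈ bundle a k, v i j) ≤ (∑ j ∈ bundle a i, v i j) ∨
    ∃ j ∈ bundle a k, (∑ j' ∈ (bundle a k).erase j, v i j') ≤ ∑ j ∈ bundle a i, v i j

/-- Pareto efficiency with respect to integral allocations (real valuations). -/
def POR {n m : ℕ} (v : Fin n → Fin m → ℝ) (a : Fin m → Fin n) : Prop :=
  ¬ ∃ b : Fin m → Fin n,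
      (∀ i, (∑ j ∈ bundle a i, v i j) ≤ ∑ j ∈ bundle b i, v i j) ∧
      ∃ i, (∑ j ∈ bundle a i, v i j) < ∑ j ∈ bundle b i, v i j

/-- Summing over all goods is the same as summing over bundles and then over agents. -/
lemma sum_bundle {n m : ℕ} (a : Fin m → Fin n) (f : Fin n → Fin m → ℝ) :
    ∑ i, ∑ j ∈ bundle a i, f i j = ∑ j, f (a j) j := by
  rw [← Finset.sum_fiberwise Finset.univ a (fun j => f (a j) j)]
  refine Finset.sum_congr rfl fun i _ => Finset.sum_congr rfl fun j hj => ?_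
  rw [(Finset.mem_filter.mp hj).2]

/-- If every good is worth at most `u j` to every agent, the Nash social welfare is at most
`(∑ j, u j) / n`. -/
lemma NSW_le_of_le {n m : ℕ} (hn : n ≠ 0) {v : Fin n → Fin m → ℝ} (hv : ∀ i j, 0 ≤ v i j)
    {u : Fin m → ℝ} (hu : ∀ i j, v i j ≤ u j) (a : Fin m → Fin n) :
    NSW v a ≤ (n : ℝ)⁻¹ * ∑ j, u j := by
  have hnonneg : ∀ i, 0 ≤ ∑ j ∈ bundle a i, v i j := fun i =>
    Finset.sum_nonneg fun j _ => hv i j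
  have hamgm := Real.geom_mean_le_arith_mean_weighted Finset.univ (fun _ : Fin n => (n : ℝ)⁻¹)
    (fun i => ∑ j ∈ bundle a i, v i j) (fun _ _ => by positivity)
    (by simp [hn]) (fun i _ => hnonneg i)
  rw [Real.finsetProd_rpow _ _ (fun i _ => hnonneg i), ← Finset.mul_sum, sum_bundle] at hamgm
  refine hamgm.trans ?_
  gcongr with j
  exact hu _ _

/-- If the bundle values multiply to `c ^ n`, the Nash social welfare is `c`. -/
lemma NSW_eq_of_prod_eq_pow {n m : ℕ} (hn : n ≠ 0) {v : Fin n → Fin m → ℝ} {a : Fin m → Fin n}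
    {c : ℝ} (hc : 0 ≤ c) (h : ∏ i, ∑ j ∈ bundle a i, v i j = c ^ n) : NSW v a = c := by
  rw [NSW, h, Real.pow_rpow_inv_natCast hc hn]

/-- An allocation approximating the optimal Nash social welfare within a factor 2 need be
neither EF1 nor Pareto efficient. Goods `0, …, 2n-3` are worth `2^{n-1}` to everyone;
goods `2n-2` and `2n-1` are worth `0` to agents `0, …, n-2`, and worth `1` and `2^n - 1`
respectively to agent `n-1`. The allocation `y` gives goods `{0, 1, 2n-1}` to agent `0`,
goods `{2i, 2i+1}` to agent `i` for `1 ≤ i ≤ n-2`, and good `2n-2` to agent `n-1`. -/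
theorem approx_nsw_not_ef1_not_po (n : ℕ) (hn : 2 ≤ n) :
    let v : Fin n → Fin (2 * n) → ℝ := fun i j =>
      if j.val < 2 * n - 2 then (2 : ℝ) ^ (n - 1)
      else if i.val < n - 1 then 0
      else if j.val = 2 * n - 2 then 1
      else 2 ^ n - 1
    let a : Fin (2 * n) → Fin n := fun j =>
      if j.val = 2 * n - 1 then ⟨0, by omega⟩
      else if j.val = 2 * n - 2 then ⟨n - 1, by omega⟩
      else ⟨j.val / 2, by have := j.isLt; omega⟩
    NSW v a = 2 ^ (n - 1) ∧
    (∀ xstar : Fin (2 * n) → Fin n, (∀ b, NSW v b ≤ NSW v xstar) →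
      NSW v xstar = 2 ^ n ∧ 2 * NSW v a ≥ NSW v xstar) ∧
    ¬ EF1R v a ∧ ¬ POR v a := by
  intro v a
  have htwo : (2 : ℝ) ^ n = 2 ^ (n - 1) + 2 ^ (n - 1) := by
    rw [← two_mul, ← pow_succ', Nat.sub_add_cancel (by omega)]
  have hpow : (2 : ℝ) ≤ 2 ^ (n - 1) := le_self_pow₀ (by norm_num) (by omega)
  let last : Fin n := ⟨n - 1, by omega⟩
  let zero : Fin n := ⟨0, by omega⟩
  let b : Fin (2 * n) → Fin n := fun j => ⟨j.val / 2, by have := j.isLt; omega⟩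
  have hv_nonneg : ∀ i j, 0 ≤ v i j := by
    intro i j
    simp only [v]
    split_ifs <;> linarith
  have hv_le : ∀ i j, v i j ≤ v last j := by
    intro i j
    simp only [v, last, lt_irrefl, if_false]
    split_ifs <;> linarith
  have hbundle_b : ∀ k : Fin n,
      bundle b k = {⟨2 * k.val, by omega⟩, ⟨2 * k.val + 1, by omega⟩} := by
    intro k
    ext j
    simp only [bundle, b, mem_filter, mem_univ, true_and, mem_insert, mem_singleton, Fin.ext_iff]
    omega
  have hbundle_last : bundle a last = {⟨2 * n - 2, by omega⟩} := by
    ext j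
    simp only [bundle, a, last, mem_filter, mem_univ, true_and, mem_singleton, Fin.ext_iff]
    split_ifs <;> simp only [true_iff] <;> omega
  have hbundle_zero :
      bundle a zero = {⟨0, by omega⟩, ⟨1, by omega⟩, ⟨2 * n - 1, by omega⟩} := by
    ext j
    simp only [bundle, a, zero, mem_filter, mem_univ, true_and, mem_insert, mem_singleton,
      Fin.ext_iff]
    split_ifs <;> simp only [true_iff] <;> omega
  have hbundle_mid : ∀ k : Fin n, k ≠ zero → k ≠ last → bundle a k = bundle b k := by
    intro k hk0 hkl
    ext j
    simp only [ne_eq, zero, last, Fin.ext_iff] at hk0 hkl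
    simp only [bundle, a, b, mem_filter, mem_univ, true_and, Fin.ext_iff]
    split_ifs <;> simp only <;> omega
  have hval_b : ∀ k : Fin n, ∀ i, i = k ∨ i = last → ∑ j ∈ bundle b k, v i j = 2 ^ n := by
    intro k i hi
    rw [hbundle_b, Finset.sum_pair (by simp)]
    simp only [v]
    by_cases hk : k.val < n - 1
    · rw [if_pos (by omega), if_pos (by omega), htwo]
    · have hil : ¬ i.val < n - 1 := by
        rcases hi with rfl | rfl
        · exact hk
        · simp [last]
      rw [if_neg (by omega), if_neg hil, if_pos (by omega), if_neg (by omega), if_neg hil,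
        if_neg (by omega)]
      ring
  have hval_last : ∑ j ∈ bundle a last, v last j = 1 := by
    rw [hbundle_last, Finset.sum_singleton]
    simp [v, last]
  have hval_zero : ∑ j ∈ bundle a zero, v zero j = 2 ^ n := by
    rw [hbundle_zero, Finset.sum_insert (by simp [Fin.ext_iff]; omega),
      Finset.sum_pair (by simp [Fin.ext_iff]; omega)]
    simp only [v, zero]
    rw [if_pos (by omega), if_pos (by omega), if_neg (by omega), if_pos (by omega), htwo, add_zero]
  have hval : ∀ k, k ≠ last → ∑ j ∈ bundle a k, v k j = 2 ^ n := by
    intro k hkl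
    by_cases hk0 : k = zero
    · rw [hk0, hval_zero]
    · rw [hbundle_mid k hk0 hkl, hval_b k k (Or.inl rfl)]
  have hNSW_a : NSW v a = 2 ^ (n - 1) := by
    apply NSW_eq_of_prod_eq_pow (by omega) (by positivity)
    rw [← Finset.mul_prod_erase _ _ (Finset.mem_univ last), hval_last, one_mul,
      Finset.prod_congr rfl fun k hk => hval k (Finset.ne_of_mem_erase hk)]
    simp [pow_right_comm]
  have hNSW_b : NSW v b = 2 ^ n := by
    apply NSW_eq_of_prod_eq_pow (by omega) (by positivity)
    simp [fun k => hval_b k k (Or.inl rfl)]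
  have hNSW_le : ∀ x, NSW v x ≤ 2 ^ n := by
    intro x
    refine (NSW_le_of_le (by omega) hv_nonneg hv_le x).trans_eq ?_
    rw [← sum_bundle b (fun _ => v last), Finset.sum_congr rfl fun k _ => hval_b k last (Or.inr rfl)]
    have : (n : ℝ) ≠ 0 := by positivity
    simp [this]
  refine ⟨hNSW_a, fun x hx => ?_, fun hEF => ?_, fun hPO => hPO ⟨b, fun i => ?_, last, ?_⟩⟩
  · have hNSW_x : NSW v x = 2 ^ n := le_antisymm (hNSW_le x) (hNSW_b ▸ hx b)
    exact ⟨hNSW_x, by rw [hNSW_x, hNSW_a, htwo]; linarith⟩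
  · have hgood : ∀ j ∈ bundle a zero, 1 < v last j := by
      intro j hmem
      have hj : j.val ≠ 2 * n - 2 := by
        simp only [hbundle_zero, mem_insert, mem_singleton, Fin.ext_iff] at hmem
        omega
      simp only [v, last, hj, lt_irrefl, if_false]
      split_ifs <;> linarith
    have hcard : (bundle a zero).card = 3 := by
      rw [hbundle_zero]
      refine Finset.card_eq_three.mpr ⟨_, _, _, ?_, ?_, ?_, rfl⟩ <;>
        simp only [ne_eq, Fin.ext_iff] <;> omega
    have hlarge : ∀ s ⊆ bundle a zero, s.Nonempty → 1 < ∑ j ∈ s, v last j := by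
      rintro s hs ⟨j, hj⟩
      exact (hgood j (hs hj)).trans_le
        (Finset.single_le_sum (f := v last) (fun j _ => hv_nonneg last j) hj)
    rcases hEF last zero with h | ⟨j, hj, h⟩ <;> rw [hval_last] at h
    · exact absurd h (hlarge _ subset_rfl (Finset.card_pos.mp (by omega))).not_ge
    · refine absurd h (hlarge _ (Finset.erase_subset _ _) (Finset.card_pos.mp ?_)).not_ge
      rw [Finset.card_erase_of_mem hj]
      omega
  · rw [hval_b i i (Or.inl rfl)]
    by_cases hi : i = last
    · rw [hi, hval_last]
      linarith
    · rw [hval i hi]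
  · rw [hval_last, hval_b last last (Or.inl rfl)]
    linarith
end
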